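/- arXiv:1004.4221 — 3 statements merged into one kernel-verified Lean document; each statement's English description precedes it below -/
import Mathlib

section
/- Let p ∈ [1,2] and let X be a Banach space. Then X has Rademacher type p if and only if X has scaled Enflo type p; that is, X has Rademacher type p if and only if there exists a constant θ < ∞ such that for every n ∈ ℕ there exists an even integer m such that for every f : ℤ_m^n → X one has E_{x,ε}[ ‖f(x + (m/2)ε) − f(x)‖_X^p ] ≤ θ^p m^p Σ_{j=1}^n E_x[ ‖f(x + e_j) − f(x)‖_X^p ], where x is uniform in ℤ_m^n and ε is uniform in {−1,1}^n. -/
open Finset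

/-- A Banach space `X` has Rademacher type `p` with constant `T`:
for every `n` and every `v : Fin n → X`,
`𝔼_ε ‖∑ j, ε j • v j‖ ^ p ≤ T ^ p * ∑ j, ‖v j‖ ^ p`, where `ε` is uniform on `{-1,1}^n`. -/
def RademacherType (X : Type*) [NormedAddCommGroup X] [NormedSpace ℝ X] (p T : ℝ) : Prop :=
  ∀ (n : ℕ) (v : Fin n → X),
    (∑ ε : Fin n → Bool, ‖∑ j, (if ε j then (1 : ℝ) else -1) • v j‖ ^ p) / 2 ^ n ≤
      T ^ p * ∑ j, ‖v j‖ ^ p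

/-- The element of `ℤ_m^n` corresponding to a sign vector `ε ∈ {-1,1}^n`,
via the natural map `ℤ → ℤ/mℤ` applied coordinatewise. -/
def signVec (m n : ℕ) (ε : Fin n → Bool) : Fin n → ZMod m :=
  fun i => if ε i then 1 else -1

set_option linter.unusedSectionVars false

section forward
variable {X : Type*} [NormedAddCommGroup X] [NormedSpace ℝ X]

/-- unnormalised `L_p` norm -/
noncomputable def NN (p : ℝ) {ι : Type*} [Fintype ι] (f : ι → X) : ℝ :=
  (∑ x, ‖f x‖ ^ p) ^ (1 / p)

variable {p : ℝ} {ι : Type*} [Fintype ι]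

lemma NN_nonneg (f : ι → X) : 0 ≤ NN p f := by unfold NN; positivity

lemma NN_pow (hp : 1 ≤ p) (f : ι → X) : NN p f ^ p = ∑ x, ‖f x‖ ^ p := by
  unfold NN
  rw [← Real.rpow_mul (by positivity), one_div_mul_cancel (by positivity), Real.rpow_one]

lemma NN_add_le (hp : 1 ≤ p) (f g : ι → X) : NN p (fun x => f x + g x) ≤ NN p f + NN p g := by
  unfold NN
  have h := Real.Lp_add_le univ (fun x => ‖f x‖) (fun x => ‖g x‖) hp
  simp only [abs_norm] at h
  refine le_trans ?_ h
  apply Real.rpow_le_rpow (by positivity) _ (by positivity)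
  apply Finset.sum_le_sum
  intro x _
  rw [abs_of_nonneg (by positivity)]
  exact Real.rpow_le_rpow (by positivity) (norm_add_le _ _) (by positivity)

lemma NN_zero (hp : 1 ≤ p) : NN p (fun _ : ι => (0 : X)) = 0 := by
  have : p ≠ 0 := by positivity
  have h2 : p⁻¹ ≠ 0 := inv_ne_zero this
  simp [NN, Real.zero_rpow this, Real.zero_rpow h2]

lemma NN_smul (hp : 1 ≤ p) (c : ℝ) (f : ι → X) : NN p (fun x => c • f x) = |c| * NN p f := by
  unfold NN
  simp only [norm_smul, Real.norm_eq_abs]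
  simp_rw [Real.mul_rpow (abs_nonneg c) (norm_nonneg _)]
  rw [← Finset.mul_sum, Real.mul_rpow (by positivity) (by positivity),
    ← Real.rpow_mul (by positivity), mul_one_div_cancel (by positivity), Real.rpow_one]

lemma NN_sum_le (hp : 1 ≤ p) {κ : Type*} (s : Finset κ) (F : κ → ι → X) :
    NN p (fun x => ∑ k ∈ s, F k x) ≤ ∑ k ∈ s, NN p (F k) := by
  classical
  induction s using Finset.induction_on with
  | empty => simp [NN_zero hp]
  | insert a s ha ih =>
    simp only [Finset.sum_insert ha]
    exact (NN_add_le hp _ _).trans (by gcongr)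

variable {G : Type*} [Fintype G] [AddCommGroup G]

lemma NN_shift (f : G → X) (u : G) : NN p (fun x => f (x + u)) = NN p f := by
  unfold NN
  congr 1
  exact Equiv.sum_comp (Equiv.addRight u) (fun x => ‖f x‖ ^ p)

/-- modulus of continuity -/
noncomputable def WW (p : ℝ) (f : G → X) (u : G) : ℝ := NN p (fun x => f (x + u) - f x)

lemma WW_add (hp : 1 ≤ p) (f : G → X) (u v : G) : WW p f (u + v) ≤ WW p f u + WW p f v := by
  have h := NN_add_le hp (fun x => f (x + u) - f x) (fun x => f (x + u + v) - f (x + u))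
  have h2 := NN_shift (p := p) (fun x => f (x + v) - f x) u
  rw [h2] at h
  unfold WW
  convert h using 3 with x
  rw [add_assoc]; abel

lemma WW_neg (f : G → X) (u : G) : WW p f (-u) = WW p f u := by
  unfold WW
  rw [← NN_shift _ u]
  unfold NN
  simp only [add_neg_cancel_right]
  congr 2
  ext x
  rw [norm_sub_rev]

lemma WW_zero (hp : 1 ≤ p) (f : G → X) : WW p f 0 = 0 := by
  simp [WW, NN_zero hp]

lemma WW_nsmul (hp : 1 ≤ p) (f : G → X) (u : G) (k : ℕ) : WW p f (k • u) ≤ k * WW p f u := by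
  induction k with
  | zero => simp [WW_zero hp]
  | succ k ih =>
    rw [succ_nsmul]
    refine (WW_add hp _ _ _).trans ?_
    push_cast
    linarith

lemma WW_sum (hp : 1 ≤ p) (f : G → X) {κ : Type*} (s : Finset κ) (u : κ → G) (δ : ℝ)
    (h : ∀ k, WW p f (u k) ≤ δ) : WW p f (∑ k ∈ s, u k) ≤ s.card * δ := by
  classical
  induction s using Finset.induction_on with
  | empty => simp [WW_zero hp]
  | insert a s ha ih =>
    rw [Finset.sum_insert ha, Finset.card_insert_of_notMem ha]
    refine (WW_add hp _ _ _).trans ?_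
    push_cast
    linarith [h a]

/-- one-dimensional average -/
noncomputable def avg1 (r : ℕ) (e : G) (f : G → X) : G → X :=
  fun x => (r : ℝ)⁻¹ • ∑ s ∈ range r, f (x + s • e)

lemma avg1_contr (hp : 1 ≤ p) (r : ℕ) (hr : 0 < r) (e : G) (f : G → X) :
    NN p (avg1 r e f) ≤ NN p f := by
  unfold avg1
  rw [NN_smul hp]
  have h := NN_sum_le hp (range r) (fun s x => f (x + s • e))
  simp only [NN_shift, sum_const, card_range, nsmul_eq_mul] at h
  have hr' : (0 : ℝ) < r := by exact_mod_cast hr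
  rw [abs_of_pos (by positivity)]
  calc _ ≤ (r : ℝ)⁻¹ * (r * NN p f) := by gcongr
    _ = _ := by field_simp

/-- difference operator -/
def DD (e : G) (f : G → X) : G → X := fun x => f (x + e) - f x

lemma avg1_DD (r : ℕ) (e e' : G) (f : G → X) : DD e' (avg1 r e f) = avg1 r e (DD e' f) := by
  ext x
  simp only [DD, avg1, ← smul_sub, ← Finset.sum_sub_distrib, add_right_comm x e']

lemma avg1_smooth (hp : 1 ≤ p) (r : ℕ) (hr : 0 < r) (e : G) (f : G → X) :
    NN p (DD e (avg1 r e f)) ≤ 2 / r * NN p f := by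
  have hr' : (0 : ℝ) < r := by exact_mod_cast hr
  have h1 : DD e (avg1 r e f) = fun x => (r : ℝ)⁻¹ • (f (x + r • e) + (-1 : ℝ) • f x) := by
    ext x
    simp only [DD, avg1, ← smul_sub, ← Finset.sum_sub_distrib]
    have := Finset.sum_range_sub (fun s : ℕ => f (x + s • e)) r
    simp only [zero_smul, add_zero, succ_nsmul] at this
    rw [neg_one_smul, ← sub_eq_add_neg, ← this]
    congr 2
    ext s
    rw [add_right_comm, add_assoc x]
  rw [h1, NN_smul hp]
  have h2 := NN_add_le hp (fun x => f (x + r • e)) (fun x => (-1 : ℝ) • f x)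
  rw [NN_smul hp, NN_shift] at h2
  rw [abs_of_pos (by positivity)]
  calc _ ≤ (r : ℝ)⁻¹ * (NN p f + |(-1 : ℝ)| * NN p f) := by gcongr
    _ = _ := by rw [abs_neg, abs_one]; ring

lemma avg1_close (hp : 1 ≤ p) (r : ℕ) (hr : 0 < r) (e : G) (f : G → X) :
    NN p (fun x => avg1 r e f x - f x) ≤ r * NN p (DD e f) := by
  have hr' : (0 : ℝ) < r := by exact_mod_cast hr
  have h1 : (fun x => avg1 r e f x - f x) =
      fun x => (r : ℝ)⁻¹ • ∑ s ∈ range r, (f (x + s • e) - f x) := by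
    ext x
    simp only [avg1, Finset.sum_sub_distrib, sum_const, card_range, smul_sub]
    rw [← Nat.cast_smul_eq_nsmul ℝ, smul_smul, inv_mul_cancel₀ hr'.ne', one_smul]
  rw [h1, NN_smul hp, abs_of_pos (by positivity)]
  have h := NN_sum_le hp (range r) (fun s x => f (x + s • e) - f x)
  have h2 : ∑ s ∈ range r, NN p (fun x => f (x + s • e) - f x) ≤
      ∑ s ∈ range r, (r * NN p (DD e f)) := by
    apply Finset.sum_le_sum
    intro s hs
    refine (WW_nsmul hp f e s).trans ?_
    have : (s : ℝ) ≤ r := by exact_mod_cast (mem_range.1 hs).le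
    exact mul_le_mul_of_nonneg_right this (NN_nonneg _)
  simp only [sum_const, card_range, nsmul_eq_mul] at h2
  calc _ ≤ (r : ℝ)⁻¹ * (r * (r * NN p (DD e f))) := by gcongr; exact h.trans h2
    _ = _ := by field_simp

/-- iterated average -/
noncomputable def avgL (r : ℕ) {κ : Type*} (e : κ → G) (f : G → X) : List κ → (G → X)
  | [] => f
  | j :: L => avg1 r (e j) (avgL r e f L)

variable {κ : Type*} (e : κ → G) (f : G → X) (r : ℕ)

lemma avgL_contr (hp : 1 ≤ p) (hr : 0 < r) (L : List κ) : NN p (avgL r e f L) ≤ NN p f := by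
  induction L with
  | nil => exact le_rfl
  | cons j L ih => exact (avg1_contr hp r hr _ _).trans ih

lemma avgL_DD (e' : G) (L : List κ) : DD e' (avgL r e f L) = avgL r e (DD e' f) L := by
  induction L with
  | nil => rfl
  | cons j L ih => simp only [avgL]; rw [avg1_DD, ih]

lemma avgL_smooth (hp : 1 ≤ p) (hr : 0 < r) (L : List κ) (i : κ) (hi : i ∈ L) :
    NN p (DD (e i) (avgL r e f L)) ≤ 2 / r * NN p f := by
  induction L with
  | nil => simp at hi
  | cons j L ih =>
    simp only [avgL]
    by_cases hij : i = j
    · subst hij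
      refine (avg1_smooth hp r hr _ _).trans ?_
      gcongr
      exact avgL_contr e f r hp hr L
    · rw [avg1_DD]
      refine (avg1_contr hp r hr _ _).trans (ih ?_)
      simpa [hij] using hi

lemma avgL_close (hp : 1 ≤ p) (hr : 0 < r) (L : List κ) (S : ℝ)
    (hS : ∀ i, NN p (DD (e i) f) ≤ S) :
    NN p (fun x => avgL r e f L x - f x) ≤ L.length * (r * S) := by
  induction L with
  | nil => simp [avgL, NN_zero hp]
  | cons j L ih =>
    have h := NN_add_le hp (fun x => avg1 r (e j) (avgL r e f L) x - avgL r e f L x)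
      (fun x => avgL r e f L x - f x)
    simp only [sub_add_sub_cancel] at h
    have h2 := avg1_close hp r hr (e j) (avgL r e f L)
    have h3 : NN p (DD (e j) (avgL r e f L)) ≤ S := by
      rw [avgL_DD]; exact (avgL_contr e _ r hp hr L).trans (hS j)
    have h4 : (r : ℝ) * NN p (DD (e j) (avgL r e f L)) ≤ r * S := by gcongr
    simp only [avgL, List.length_cons]
    push_cast
    linarith

/-- real sign -/
def sg (b : Bool) : ℝ := if b then 1 else -1

/-- signed element -/
def sgG (b : Bool) (u : G) : G := if b then u else -u

lemma WW_sgG (b : Bool) (u : G) : WW p f (sgG b u) = WW p f u := by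
  cases b
  · simpa [sgG] using WW_neg f u
  · simp [sgG]

/-- linearisation at a sign vector -/
lemma linearise (hp : 1 ≤ p) [Fintype κ] (g : G → X) (δ : ℝ)
    (hδ : ∀ i j, WW p (DD (e j) g) (e i) ≤ δ) (ε : κ → Bool) (s : Finset κ) :
    NN p (fun x => (g (x + ∑ j ∈ s, sgG (ε j) (e j)) - g x) - ∑ j ∈ s, sg (ε j) • DD (e j) g x)
      ≤ s.card * ((Fintype.card κ + 1) * δ) := by
  classical
  induction s using Finset.induction_on with
  | empty => simp [NN_zero hp]
  | insert a s ha ih =>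
    rw [Finset.card_insert_of_notMem ha]
    set v := ∑ j ∈ s, sgG (ε j) (e j) with hv
    set w : G := if ε a then 0 else - e a with hw
    have hδ0 : 0 ≤ δ := (NN_nonneg _).trans (hδ a a)
    have h1 : WW p (DD (e a) g) (v + w) ≤ (Fintype.card κ + 1) * δ := by
      refine (WW_add hp _ _ _).trans ?_
      have h2 : WW p (DD (e a) g) v ≤ s.card * δ :=
        WW_sum hp _ s _ δ (fun k => by rw [WW_sgG]; exact hδ k a)
      have h3 : WW p (DD (e a) g) w ≤ δ := by
        rw [hw]; split_ifs
        · rw [WW_zero hp]; exact hδ0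
        · rw [WW_neg]; exact hδ a a
      have h4 : (s.card : ℝ) ≤ Fintype.card κ := by exact_mod_cast s.card_le_univ
      have h5 : (s.card : ℝ) * δ ≤ Fintype.card κ * δ := by gcongr
      linarith
    have h := NN_add_le hp (fun x => (g (x + v) - g x) - ∑ j ∈ s, sg (ε j) • DD (e j) g x)
      (fun x => sg (ε a) • (DD (e a) g (x + (v + w)) - DD (e a) g x))
    rw [NN_smul hp] at h
    have habs : |sg (ε a)| = 1 := by cases ε a <;> simp [sg]
    rw [habs, one_mul] at h
    have heq : (fun x => (g (x + ∑ j ∈ insert a s, sgG (ε j) (e j)) - g x) -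
        ∑ j ∈ insert a s, sg (ε j) • DD (e j) g x) = fun x =>
        ((g (x + v) - g x) - ∑ j ∈ s, sg (ε j) • DD (e j) g x) +
        (sg (ε a) • (DD (e a) g (x + (v + w)) - DD (e a) g x)) := by
      ext x
      rw [Finset.sum_insert ha, Finset.sum_insert ha, ← hv]
      have key : g (x + (sgG (ε a) (e a) + v)) - g (x + v) = sg (ε a) • DD (e a) g (x + (v + w)) := by
        rw [hw]
        cases ε a
        · simp only [sgG, sg, DD, Bool.false_eq_true, if_false, neg_one_smul, neg_sub]
          congr 2 <;> abel
        · simp only [sgG, sg, DD, if_true, one_smul, add_zero]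
          congr 2; abel
      rw [smul_sub, ← key]
      abel
    rw [heq]
    push_cast
    unfold WW at h1
    linarith

lemma forward_core (hp : 1 ≤ p) (n : ℕ) (e : Fin n → G) (f : G → X) (T : ℝ) (hT : 0 ≤ T)
    (hX : ∀ v : Fin n → X, (∑ ε : Fin n → Bool, ‖∑ j, sg (ε j) • v j‖ ^ p) ≤
      2 ^ n * (T ^ p * ∑ j, ‖v j‖ ^ p)) (k : ℕ) (hk : k = (n * (n + 1) + 1) * (n + 1)) :
    ∑ ε : Fin n → Bool, ∑ x, ‖f (x + k • ∑ j, sgG (ε j) (e j)) - f x‖ ^ p ≤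
      2 ^ n * (((4 + T) * (2 * k)) ^ p * ∑ j, ∑ x, ‖f (x + e j) - f x‖ ^ p) := by
  set r := n * (n + 1) + 1 with hrdef
  have hr : 0 < r := by omega
  have hr' : (0 : ℝ) < r := by exact_mod_cast hr
  have hrR : (r : ℝ) = n * (n + 1) + 1 := by rw [hrdef]; push_cast; ring
  set Q := ∑ j, ∑ x, ‖f (x + e j) - f x‖ ^ p with hQ
  have hQ0 : 0 ≤ Q := by positivity
  set S := Q ^ (1 / p) with hS
  have hS0 : 0 ≤ S := by positivity
  have hSp : S ^ p = Q := by
    rw [hS, ← Real.rpow_mul (by positivity), one_div_mul_cancel (by positivity), Real.rpow_one]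
  have hDS : ∀ i, NN p (DD (e i) f) ≤ S := by
    intro i
    apply Real.rpow_le_rpow (by positivity) _ (by positivity)
    exact Finset.single_le_sum (f := fun j => ∑ x, ‖f (x + e j) - f x‖ ^ p)
      (fun j _ => by positivity) (mem_univ i)
  set g := avgL r e f (List.finRange n) with hg
  have hclose : NN p (fun x => g x - f x) ≤ n * (r * S) := by
    simpa using avgL_close e f r hp hr (List.finRange n) S hDS
  have hδ : ∀ i j, WW p (DD (e j) g) (e i) ≤ 2 / r * S := by
    intro i j
    rw [hg, avgL_DD]
    refine (avgL_smooth e (DD (e j) f) r hp hr _ i (List.mem_finRange i)).trans ?_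
    have := hDS j
    gcongr
  set M : (Fin n → Bool) → G → X := fun ε x => ∑ j, sg (ε j) • DD (e j) g x with hM
  have hWg : ∀ ε : Fin n → Bool, WW p g (∑ j, sgG (ε j) (e j)) ≤ 2 * S + NN p (M ε) := by
    intro ε
    have h1 := linearise e hp g _ hδ ε univ
    have h2 := NN_add_le hp (fun x => (g (x + ∑ j, sgG (ε j) (e j)) - g x) -
      ∑ j, sg (ε j) • DD (e j) g x) (M ε)
    simp only [hM, sub_add_cancel] at h2
    simp only [card_univ, Fintype.card_fin] at h1
    have h3 : (n : ℝ) * ((n + 1) * (2 / r * S)) ≤ 2 * S := by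
      have : (n : ℝ) * ((n + 1) * (2 / r * S)) = (n * (n + 1) / r) * (2 * S) := by ring
      rw [this]
      have h4 : (n * (n + 1) / r : ℝ) ≤ 1 := by
        rw [div_le_one hr', hrR]; linarith
      nlinarith
    unfold WW
    simp only [hM]
    linarith
  have hkR : (k : ℝ) = r * (n + 1) := by rw [hk]; push_cast; ring
  have hWf : ∀ ε : Fin n → Bool, WW p f (k • ∑ j, sgG (ε j) (e j)) ≤ k * (4 * S + NN p (M ε)) := by
    intro ε
    set u := k • ∑ j, sgG (ε j) (e j) with hu
    have h1 : WW p g u ≤ k * (2 * S + NN p (M ε)) :=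
      (WW_nsmul hp _ _ _).trans (by have := hWg ε; gcongr)
    have h2 := NN_add_le hp (fun x => (-1 : ℝ) • (g (x + u) - f (x + u)))
      (fun x => (g (x + u) - g x) + (g x - f x))
    have h3 := NN_add_le hp (fun x => g (x + u) - g x) (fun x => g x - f x)
    rw [NN_smul hp, NN_shift (fun x => g x - f x) u, abs_neg, abs_one, one_mul] at h2
    have heq : (fun x => (-1 : ℝ) • (g (x + u) - f (x + u)) + ((g (x + u) - g x) + (g x - f x)))
      = fun x => f (x + u) - f x := by
      ext x; rw [neg_one_smul]; abel
    rw [heq] at h2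
    unfold WW at h1 ⊢
    have h5 : (n : ℝ) * (r * S) ≤ k * S := by
      rw [hkR]; nlinarith [mul_nonneg hr'.le hS0]
    linarith
  have hpow : ∀ ε : Fin n → Bool, ∑ x, ‖f (x + k • ∑ j, sgG (ε j) (e j)) - f x‖ ^ p ≤
      (2 * k) ^ p * ((4 * S) ^ p + ∑ x, ‖M ε x‖ ^ p) := by
    intro ε
    rw [← NN_pow hp, ← NN_pow hp]
    have hN := NN_nonneg (p := p) (M ε)
    calc _ ≤ (k * (4 * S + NN p (M ε))) ^ p :=
          Real.rpow_le_rpow (NN_nonneg _) (hWf ε) (by positivity)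
      _ ≤ ((2 * k) * max (4 * S) (NN p (M ε))) ^ p := by
          apply Real.rpow_le_rpow (by positivity) _ (by positivity)
          have := le_max_left (4 * S) (NN p (M ε))
          have := le_max_right (4 * S) (NN p (M ε))
          calc _ ≤ (k : ℝ) * (max (4 * S) (NN p (M ε)) + max (4 * S) (NN p (M ε))) := by gcongr
            _ = _ := by ring
      _ = (2 * k) ^ p * (max (4 * S) (NN p (M ε))) ^ p :=
          Real.mul_rpow (by positivity) (by positivity)
      _ ≤ _ := by
          gcongr
          rcases max_choice (4 * S) (NN p (M ε)) with h | h <;> rw [h]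
          · have : 0 ≤ NN p (M ε) ^ p := by positivity
            linarith
          · have : 0 ≤ (4 * S) ^ p := by positivity
            linarith
  have hMsum : ∑ ε, ∑ x, ‖M ε x‖ ^ p ≤ 2 ^ n * (T ^ p * Q) := by
    rw [Finset.sum_comm]
    calc _ ≤ ∑ x, 2 ^ n * (T ^ p * ∑ j, ‖DD (e j) g x‖ ^ p) :=
          Finset.sum_le_sum fun x _ => hX (fun j => DD (e j) g x)
      _ = 2 ^ n * (T ^ p * ∑ j, ∑ x, ‖DD (e j) g x‖ ^ p) := by
          rw [← Finset.mul_sum, ← Finset.mul_sum, Finset.sum_comm]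
      _ ≤ _ := by
          gcongr
          rw [hQ]
          apply Finset.sum_le_sum
          intro j _
          rw [← NN_pow hp]
          have : ∑ x, ‖f (x + e j) - f x‖ ^ p = NN p (DD (e j) f) ^ p := (NN_pow hp _).symm
          rw [this]
          apply Real.rpow_le_rpow (NN_nonneg _) _ (by positivity)
          rw [hg, avgL_DD]
          exact avgL_contr e _ r hp hr _
  calc _ ≤ ∑ ε : Fin n → Bool, (2 * k : ℝ) ^ p * ((4 * S) ^ p + ∑ x, ‖M ε x‖ ^ p) :=
        Finset.sum_le_sum fun ε _ => hpow ε
    _ = (2 * k) ^ p * (2 ^ n * (4 * S) ^ p + ∑ ε, ∑ x, ‖M ε x‖ ^ p) := by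
        rw [← Finset.mul_sum, Finset.sum_add_distrib]; simp
    _ ≤ (2 * k) ^ p * (2 ^ n * (4 * S) ^ p + 2 ^ n * (T ^ p * Q)) := by gcongr
    _ = 2 ^ n * ((2 * k) ^ p * ((4 ^ p + T ^ p) * Q)) := by
        rw [Real.mul_rpow (by norm_num) hS0, hSp]; ring
    _ ≤ 2 ^ n * ((2 * k) ^ p * ((4 + T) ^ p * Q)) := by
        gcongr
        exact Real.add_rpow_le_rpow_add (by norm_num) hT hp
    _ = _ := by
        rw [Real.mul_rpow (x := 4 + T) (by positivity) (by positivity)]; ring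

end forward

section backward
variable {X : Type*} [NormedAddCommGroup X] [NormedSpace ℝ X] {p : ℝ}

/-- tent function on the cycle -/
noncomputable def tent (k : ℕ) {m : ℕ} (z : ZMod m) : ℝ := |(z.val : ℝ) - k|

lemma tent_lip (k m : ℕ) [NeZero m] (hm : m = 2 * k) (z : ZMod m) :
    |tent k (z + 1) - tent k z| ≤ 1 := by
  have hm0 : 0 < m := Nat.pos_of_ne_zero (NeZero.ne m)
  have hz : z.val < m := ZMod.val_lt z
  have h1 : (1 : ZMod m).val = 1 := by
    rw [ZMod.val_one_eq_one_mod, Nat.mod_eq_of_lt (by omega)]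
  have hmR : (m : ℝ) = 2 * k := by exact_mod_cast hm
  have hk1 : (1 : ℝ) ≤ k := by exact_mod_cast (by omega : 1 ≤ k)
  unfold tent
  by_cases h : z.val + 1 < m
  · rw [ZMod.val_add_of_lt (by rw [h1]; exact h), h1]
    refine (abs_abs_sub_abs_le _ _).trans ?_
    push_cast
    rw [show (z.val : ℝ) + 1 - k - (z.val - k) = 1 by ring, abs_one]
  · have h2 : z.val + 1 = m := by omega
    have h3 : (z + 1).val = 0 := by
      rw [ZMod.val_add, h1, h2, Nat.mod_self]
    have h4 : (z.val : ℝ) = 2 * k - 1 := by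
      have : (z.val : ℝ) + 1 = m := by exact_mod_cast h2
      linarith
    rw [h3, h4]
    rw [show (2 * k - 1 - k : ℝ) = k - 1 by ring, abs_of_nonneg (by linarith : (0 : ℝ) ≤ k - 1)]
    rw [show (((0 : ℕ) : ℝ) - k) = -k by simp, abs_neg, abs_of_nonneg (by linarith : (0 : ℝ) ≤ k)]
    norm_num

/-- half-period difference of the tent function -/
noncomputable def hh (k : ℕ) {m : ℕ} (z : ZMod m) : ℝ := tent k (z + (k : ZMod m)) - tent k z

lemma hh_anti (k m : ℕ) (hm : m = 2 * k) (z : ZMod m) : hh k (z + (k : ZMod m)) = - hh k z := by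
  unfold hh
  have : (k : ZMod m) + k = 0 := by
    have h := ZMod.natCast_self m
    rw [← Nat.cast_add, ← h]
    congr 1; omega
  rw [add_assoc, this, add_zero]; ring

lemma sum_sq (k : ℕ) (c : ℝ) : ∑ a ∈ range k, (2 * (a : ℝ) - c) ^ 2 =
    k * c ^ 2 - 2 * c * k * (k - 1) + 2 / 3 * (k - 1) * k * (2 * k - 1) := by
  induction k with
  | zero => simp
  | succ k ih => rw [Finset.sum_range_succ, ih]; push_cast; ring

lemma hh_sum (k m : ℕ) [NeZero m] (hm : m = 2 * k) :
    (m : ℝ) ^ 2 / 12 ≤ ∑ z : ZMod m, |hh k z| := by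
  have hm0 : 0 < m := Nat.pos_of_ne_zero (NeZero.ne m)
  have hk0 : 0 < k := by omega
  have hkR : (0 : ℝ) < k := by exact_mod_cast hk0
  have hval : ∀ a < m, ((a : ℕ) : ZMod m).val = a := fun a ha => ZMod.val_cast_of_lt ha
  have hinj : Set.InjOn (fun a : ℕ => (a : ZMod m)) (range k : Set ℕ) := by
    intro a ha b hb hab
    simp only [coe_range, Set.mem_Iio] at ha hb
    have := congrArg ZMod.val hab
    simpa [hval a (by omega), hval b (by omega)] using this
  have h1 : ∑ a ∈ range k, |hh k ((a : ℕ) : ZMod m)| ≤ ∑ z : ZMod m, |hh k z| := by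
    rw [← Finset.sum_image (f := fun z : ZMod m => |hh k z|) hinj]
    exact Finset.sum_le_sum_of_subset_of_nonneg (subset_univ _) (fun _ _ _ => abs_nonneg _)
  have h2 : ∀ a ∈ range k, (2 * (a : ℝ) - k) ^ 2 ≤ k * |hh k ((a : ℕ) : ZMod m)| := by
    intro a ha
    have ha' : a < k := mem_range.1 ha
    have haR : (a : ℝ) < k := by exact_mod_cast ha'
    have ha0 : (0 : ℝ) ≤ a := by positivity
    have : hh k ((a : ℕ) : ZMod m) = 2 * a - k := by
      unfold hh tent
      rw [← Nat.cast_add, hval _ (by omega), hval _ (by omega)]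
      push_cast
      rw [abs_of_nonneg (by linarith), abs_of_neg (by linarith)]
      ring
    rw [this, ← sq_abs, sq]
    gcongr
    rw [abs_le]; constructor <;> linarith
  have h3 := Finset.sum_le_sum h2
  rw [← Finset.mul_sum, sum_sq] at h3
  have hmR : (m : ℝ) = 2 * k := by exact_mod_cast hm
  rw [hmR]
  refine le_trans ?_ h1
  have h4 : (k : ℝ) * (k ^ 2 / 3) ≤ k * ∑ a ∈ range k, |hh k ((a : ℕ) : ZMod m)| := by
    refine le_trans ?_ h3
    nlinarith
  have := le_of_mul_le_mul_left h4 hkR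
  linarith

lemma norm_sum_pow (hp : 1 ≤ p) {ι : Type*} [Fintype ι] (F : ι → X) :
    ‖∑ t, F t‖ ^ p ≤ (Fintype.card ι : ℝ) ^ (p - 1) * ∑ t, ‖F t‖ ^ p :=
  (Real.rpow_le_rpow (norm_nonneg _) (norm_sum_le _ _) (by positivity)).trans
    (Real.rpow_sum_le_const_mul_sum_rpow_of_nonneg univ hp (fun _ _ => norm_nonneg _))

lemma sign_flip (n : ℕ) (v : Fin n → X) (h : Fin n → ℝ) :
    ∑ ε : Fin n → Bool, ‖∑ j, sg (ε j) • h j • v j‖ ^ p =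
    ∑ ε : Fin n → Bool, ‖∑ j, sg (ε j) • |h j| • v j‖ ^ p := by
  let σ : (Fin n → Bool) → (Fin n → Bool) := fun ε j => if 0 ≤ h j then ε j else !(ε j)
  have hσ : Function.Involutive σ := by
    intro ε; ext j; simp only [σ]; split_ifs <;> simp
  rw [← Equiv.sum_comp hσ.toPerm]
  apply Finset.sum_congr rfl
  intro ε _
  congr 2
  apply Finset.sum_congr rfl
  intro j _
  simp only [Function.Involutive.coe_toPerm, σ]
  split_ifs with hj
  · rw [abs_of_nonneg hj]
  · rw [abs_of_neg (not_le.1 hj)]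
    cases ε j <;> simp [sg]

lemma half_flip (k m n : ℕ) [NeZero m] (hm : m = 2 * k) (v : Fin n → X) (ε : Fin n → Bool) :
    ∑ x : Fin n → ZMod m, ‖∑ j, sg (ε j) • hh k (x j) • v j‖ ^ p =
    ∑ x : Fin n → ZMod m, ‖∑ j, hh k (x j) • v j‖ ^ p := by
  let u : Fin n → ZMod m := fun j => if ε j then 0 else (k : ZMod m)
  rw [← Equiv.sum_comp (Equiv.addRight u) (fun x => ‖∑ j, hh k (x j) • v j‖ ^ p)]
  apply Finset.sum_congr rfl
  intro x _
  congr 2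
  apply Finset.sum_congr rfl
  intro j _
  simp only [Equiv.coe_addRight, Pi.add_apply, u]
  cases ε j
  · simp [sg, hh_anti k m hm]
  · simp [sg]

lemma jensen_step (hp : 1 ≤ p) (k m n : ℕ) [NeZero m] (hm : m = 2 * k) (v : Fin n → X) :
    (m : ℝ) ^ n * ((m / 12 : ℝ) ^ p * ‖∑ j, v j‖ ^ p) ≤
    ∑ x : Fin n → ZMod m, ‖∑ j, |hh k (x j)| • v j‖ ^ p := by
  have hmR : (0 : ℝ) < m := by exact_mod_cast Nat.pos_of_ne_zero (NeZero.ne m)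
  set R := ∑ x : Fin n → ZMod m, ‖∑ j, |hh k (x j)| • v j‖ ^ p with hR
  set H := ∑ z : ZMod m, |hh k z| with hH
  have hHm : (m : ℝ) ^ 2 / 12 ≤ H := hh_sum k m hm
  have hH0 : 0 ≤ H := le_trans (by positivity) hHm
  have h1 : ∑ x : Fin n → ZMod m, ∑ t : ZMod m, ‖∑ j, |hh k (x j + t)| • v j‖ ^ p = m * R := by
    rw [Finset.sum_comm]
    have : ∀ t : ZMod m, ∑ x : Fin n → ZMod m, ‖∑ j, |hh k (x j + t)| • v j‖ ^ p = R := fun t =>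
      Equiv.sum_comp (Equiv.addRight (fun _ : Fin n => t))
        (fun x => ‖∑ j, |hh k (x j)| • v j‖ ^ p)
    simp [this, ZMod.card]
  have h2 : ∀ x : Fin n → ZMod m, H ^ p * ‖∑ j, v j‖ ^ p ≤
      (m : ℝ) ^ (p - 1) * ∑ t : ZMod m, ‖∑ j, |hh k (x j + t)| • v j‖ ^ p := by
    intro x
    have h := norm_sum_pow hp (fun t : ZMod m => ∑ j, |hh k (x j + t)| • v j)
    rw [Finset.sum_comm, ZMod.card] at h
    have h3 : ∑ j, ∑ t : ZMod m, |hh k (x j + t)| • v j = H • ∑ j, v j := by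
      rw [Finset.smul_sum]
      apply Finset.sum_congr rfl
      intro j _
      rw [← Finset.sum_smul]
      congr 1
      exact Equiv.sum_comp (Equiv.addLeft (x j)) (fun z => |hh k z|)
    rw [h3, norm_smul, Real.norm_of_nonneg hH0, Real.mul_rpow hH0 (norm_nonneg _)] at h
    exact h
  have h3 := Finset.sum_le_sum (fun x (_ : x ∈ (univ : Finset (Fin n → ZMod m))) => h2 x)
  rw [← Finset.mul_sum (a := (m : ℝ) ^ (p - 1)), h1, ← mul_assoc, ← Real.rpow_add_one hmR.ne', sub_add_cancel] at h3
  simp only [sum_const, card_univ, Fintype.card_pi, ZMod.card, prod_const, Fintype.card_fin,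
    nsmul_eq_mul, Nat.cast_pow] at h3
  have h4 : (m : ℝ) ^ p * (m / 12 : ℝ) ^ p ≤ H ^ p := by
    rw [← Real.mul_rpow (by positivity) (by positivity)]
    apply Real.rpow_le_rpow (by positivity) _ (by positivity)
    convert hHm using 1; ring
  have hmp : (0 : ℝ) < (m : ℝ) ^ p := by positivity
  refine le_of_mul_le_mul_left ?_ hmp
  calc _ = (m : ℝ) ^ n * (((m : ℝ) ^ p * (m / 12 : ℝ) ^ p) * ‖∑ j, v j‖ ^ p) := by ring
    _ ≤ (m : ℝ) ^ n * (H ^ p * ‖∑ j, v j‖ ^ p) := by gcongr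
    _ ≤ _ := h3

lemma backward_core (hp : 1 ≤ p) (k m n : ℕ) [NeZero m] (hm : m = 2 * k) (v : Fin n → X) :
    (m : ℝ) ^ n * ((m / 12 : ℝ) ^ p * ∑ ε : Fin n → Bool, ‖∑ j, sg (ε j) • v j‖ ^ p) ≤
    2 ^ n * ∑ x : Fin n → ZMod m, ‖∑ j, hh k (x j) • v j‖ ^ p := by
  calc _ = ∑ ε : Fin n → Bool, (m : ℝ) ^ n * ((m / 12 : ℝ) ^ p * ‖∑ j, sg (ε j) • v j‖ ^ p) := by
        rw [Finset.mul_sum, Finset.mul_sum]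
    _ ≤ ∑ ε : Fin n → Bool, ∑ x : Fin n → ZMod m, ‖∑ j, |hh k (x j)| • sg (ε j) • v j‖ ^ p :=
        Finset.sum_le_sum fun ε _ => jensen_step hp k m n hm _
    _ = ∑ ε : Fin n → Bool, ∑ x : Fin n → ZMod m, ‖∑ j, sg (ε j) • hh k (x j) • v j‖ ^ p := by
        rw [Finset.sum_comm]
        conv_rhs => rw [Finset.sum_comm]
        apply Finset.sum_congr rfl
        intro x _
        rw [sign_flip]
        apply Finset.sum_congr rfl
        intro ε _
        congr 2
        apply Finset.sum_congr rfl
        intro j _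
        exact smul_comm _ _ _
    _ = _ := by
        simp only [half_flip k m n hm v]
        simp

lemma half_signVec (k m n : ℕ) (hm : m = 2 * k) (ε : Fin n → Bool) :
    k • signVec m n ε = fun _ => (k : ZMod m) := by
  ext j
  have : (k : ZMod m) + k = 0 := by
    have h := ZMod.natCast_self m
    rw [← Nat.cast_add, ← h]
    congr 1; omega
  simp only [signVec, Pi.smul_apply, nsmul_eq_mul]
  split_ifs
  · simp
  · rw [mul_neg, mul_one]; exact neg_eq_of_add_eq_zero_left this

end backward

lemma signVec_eq (m n : ℕ) (ε : Fin n → Bool) :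
    signVec m n ε = ∑ j, sgG (ε j) (Pi.single j (1 : ZMod m) : Fin n → ZMod m) := by
  ext i
  rw [Finset.sum_apply, Finset.sum_eq_single i]
  · cases h : ε i <;> simp [signVec, sgG, h]
  · intro j _ hj
    cases ε j <;> simp [sgG, hj.symm]
  · simp


/-- A Banach space `X` has Rademacher type `p ∈ [1,2]` if and only if it has scaled Enflo
type `p`: there exists `θ < ∞` such that for every `n` there is an even integer `m` with
`𝔼_{x,ε} ‖f(x + (m/2)ε) - f(x)‖^p ≤ θ^p * m^p * ∑_j 𝔼_x ‖f(x+e_j) - f(x)‖^p`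
for every `f : ℤ_m^n → X`. -/
theorem rademacherType_iff_scaledEnfloType (p : ℝ) (hp₁ : 1 ≤ p) (hp₂ : p ≤ 2)
    (X : Type*) [NormedAddCommGroup X] [NormedSpace ℝ X] [CompleteSpace X] :
    (∃ T : ℝ, 0 ≤ T ∧ RademacherType X p T) ↔
      (∃ θ : ℝ, 0 ≤ θ ∧ ∀ n : ℕ, ∃ m : ℕ, ∃ _ : NeZero m, m % 2 = 0 ∧
        ∀ f : (Fin n → ZMod m) → X,
          (∑ x : Fin n → ZMod m, ∑ ε : Fin n → Bool,
              ‖f (x + (m / 2) • signVec m n ε) - f x‖ ^ p) / ((m : ℝ) ^ n * 2 ^ n) ≤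
            θ ^ p * (m : ℝ) ^ p * ∑ j : Fin n,
              (∑ x : Fin n → ZMod m, ‖f (x + Pi.single j 1) - f x‖ ^ p) / (m : ℝ) ^ n) := by
  constructor
  · rintro ⟨T, hT, hX⟩
    refine ⟨4 + T, by positivity, fun n => ?_⟩
    obtain ⟨k, hk⟩ : ∃ k, k = (n * (n + 1) + 1) * (n + 1) := ⟨_, rfl⟩
    have hk0 : 0 < k := by rw [hk]; positivity
    refine ⟨2 * k, ⟨by omega⟩, by omega, fun f => ?_⟩
    have : NeZero (2 * k) := ⟨by omega⟩
    have hX' : ∀ v : Fin n → X, (∑ ε : Fin n → Bool, ‖∑ j, sg (ε j) • v j‖ ^ p) ≤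
        2 ^ n * (T ^ p * ∑ j, ‖v j‖ ^ p) := by
      intro v
      have h := hX n v
      rw [div_le_iff₀ (by positivity)] at h
      rw [mul_comm]
      exact h
    have h := forward_core hp₁ n (fun j => (Pi.single j 1 : Fin n → ZMod (2 * k))) f T hT hX' k hk
    simp only [← signVec_eq] at h
    rw [Finset.sum_comm] at h
    have h2 : 2 * k / 2 = k := by omega
    rw [h2, ← Finset.sum_div, ← Real.mul_rpow (by positivity) (by positivity)]
    have hkR : (0 : ℝ) < ((2 * k : ℕ) : ℝ) := by exact_mod_cast (by omega : 0 < 2 * k)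
    rw [← div_div, div_le_iff₀ (by positivity), mul_div_assoc', div_mul_eq_mul_div]
    apply div_le_div_of_nonneg_right _ (by positivity)
    push_cast
    refine h.trans (le_of_eq (by ring))
  · rintro ⟨θ, hθ, hE⟩
    refine ⟨12 * θ, by positivity, fun n v => ?_⟩
    obtain ⟨m, hm0, hm2, hf⟩ := hE n
    obtain ⟨k, hk⟩ : ∃ k, m = 2 * k := ⟨m / 2, by omega⟩
    have hmk : m / 2 = k := by omega
    have hmR : (0 : ℝ) < m := by exact_mod_cast Nat.pos_of_ne_zero (NeZero.ne m)
    have h := hf (fun x => ∑ j, tent k (x j) • v j)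
    rw [hmk] at h
    have e1 : ∀ (x : Fin n → ZMod m) (ε : Fin n → Bool),
        ∑ j, tent k ((x + k • signVec m n ε) j) • v j - ∑ j, tent k (x j) • v j =
        ∑ j, hh k (x j) • v j := by
      intro x ε
      rw [half_signVec k m n hk, ← Finset.sum_sub_distrib]
      simp only [hh, sub_smul, Pi.add_apply]
    simp only [e1] at h
    simp only [sum_const, card_univ, Fintype.card_pi, Fintype.card_bool, prod_const,
      Fintype.card_fin, nsmul_eq_mul, Nat.cast_pow, Nat.cast_ofNat] at h
    rw [← Finset.mul_sum] at h
    have e2 : ∀ j : Fin n, (∑ x : Fin n → ZMod m, ‖∑ i, tent k ((x + Pi.single j 1 : Fin n → ZMod m) i) • v i -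
        ∑ i, tent k (x i) • v i‖ ^ p) / (m : ℝ) ^ n ≤ ‖v j‖ ^ p := by
      intro j
      rw [div_le_iff₀ (by positivity)]
      have : ∀ x : Fin n → ZMod m, ‖∑ i, tent k ((x + Pi.single j 1 : Fin n → ZMod m) i) • v i -
        ∑ i, tent k (x i) • v i‖ ^ p ≤ ‖v j‖ ^ p := by
        intro x
        apply Real.rpow_le_rpow (norm_nonneg _) _ (by positivity)
        rw [← Finset.sum_sub_distrib, Finset.sum_eq_single j]
        · rw [← sub_smul, norm_smul, Real.norm_eq_abs]
          have := tent_lip k m hk (x j)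
          simp only [Pi.add_apply, Pi.single_eq_same]
          exact mul_le_of_le_one_left (norm_nonneg _) this
        · intro i _ hi
          simp [Pi.single_eq_of_ne hi]
        · simp
      refine (Finset.sum_le_sum fun x _ => this x).trans (le_of_eq ?_)
      simp [ZMod.card, mul_comm]
    have h3 := h.trans (mul_le_mul_of_nonneg_left (Finset.sum_le_sum fun j _ => e2 j)
      (by positivity))
    have h4 := backward_core hp₁ k m n hk v
    have hgoal : (∑ ε : Fin n → Bool, ‖∑ j, sg (ε j) • v j‖ ^ p) / 2 ^ n ≤
        (12 * θ) ^ p * ∑ j, ‖v j‖ ^ p := by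
      rw [div_le_iff₀ (by positivity)] at h3 ⊢
      have hc : (0 : ℝ) < (m : ℝ) ^ n * (m / 12 : ℝ) ^ p := by positivity
      refine le_of_mul_le_mul_left ?_ hc
      have e3 : (m / 12 : ℝ) ^ p * (12 * θ) ^ p = θ ^ p * (m : ℝ) ^ p := by
        rw [← Real.mul_rpow (by positivity) (by positivity),
          ← Real.mul_rpow (by positivity) (by positivity)]
        congr 1; ring
      calc _ = (m : ℝ) ^ n * ((m / 12 : ℝ) ^ p *
            ∑ ε : Fin n → Bool, ‖∑ j, sg (ε j) • v j‖ ^ p) := by ring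
        _ ≤ _ := h4
        _ ≤ _ := h3
        _ = (m : ℝ) ^ n * ((m / 12 : ℝ) ^ p * (12 * θ) ^ p) * ((∑ j, ‖v j‖ ^ p) * 2 ^ n) := by
            rw [e3]; ring
        _ = _ := by ring
    exact hgoal
end

section
/- Let p ∈ [1,2] and let X be a Banach space with Rademacher type p with constant T. There exists a constant C = C(p,T) > 0 such that for every n ≥ 2, every even integer m ≥ 2, every odd integer k with 0 < k < m/2, all integers 0 ≤ l ≤ i ≤ n, and every f : ℤ_m^n → X, ∫_{ℤ_m^n} ∫_{{−1,1}^n} ‖R_{i,l}f(x,ε)‖_X^p dτ(ε) dμ(x) ≤ C (log n)^p · binom(n,i)^p · binom(i,l)^p · Σ_{j=1}^n ∫_{ℤ_m^n} ‖f(x + e_j) − f(x)‖_X^p dμ(x). -/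
open Finset

/-- For `A ⊆ [n]` and `ε ∈ {-1,1}^n`, the vector `ε_A ∈ ℤ_m^n` which equals `ε` on the
coordinates of `A` and `0` elsewhere. -/
def signVecOn (m n : ℕ) (A : Finset (Fin n)) (ε : Fin n → Bool) : Fin n → ZMod m :=
  fun j => if j ∈ A then (if ε j then 1 else -1) else 0

open scoped Classical in
/-- For `B ⊆ [n]`, `L_B` is the set of `y ∈ ℤ_m^n` such that `y_i = 0` for `i ∉ B`,
every coordinate `y_i` is even, and `d_{ℤ_m^n}(0,y) = ∑_i min(y_i, m - y_i) < k`. -/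
noncomputable def LB (m n k : ℕ) [NeZero m] (B : Finset (Fin n)) :
    Finset (Fin n → ZMod m) :=
  Finset.univ.filter fun y =>
    (∀ i, i ∉ B → y i = 0) ∧ (∀ i, Even (y i).val) ∧
      (∑ i, min (y i).val (m - (y i).val)) < k

/-- The averaging operator `Δ_B f(x) = (1/|L_B|) ∑_{y ∈ L_B} f(x + y)`. -/
noncomputable def Delta (m n k : ℕ) [NeZero m] {X : Type*} [NormedAddCommGroup X]
    [NormedSpace ℝ X] (B : Finset (Fin n)) (f : (Fin n → ZMod m) → X)
    (x : Fin n → ZMod m) : X :=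
  ((LB m n k B).card : ℝ)⁻¹ • ∑ y ∈ LB m n k B, f (x + y)

open scoped Classical in
/-- `R_{i,l}f(x,ε) = ∑_{S ⊆ [n], |S|=i} ∑_{δ ∈ {-1,1}^S, ⟨δ_S,ε_S⟩ = i-2l}
[Δ_{[n]∖S}f(x + kδ_S + ε_{[n]∖S}) - Δ_{[n]∖S}f(x + kδ_S - ε_{[n]∖S})]`,
where `δ ∈ {-1,1}^S` is encoded as `δ : Fin n → Bool` with `δ ≡ true` off `S`. -/
noncomputable def Rop (m n k : ℕ) [NeZero m] {X : Type*} [NormedAddCommGroup X]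
    [NormedSpace ℝ X] (i l : ℕ) (f : (Fin n → ZMod m) → X)
    (x : Fin n → ZMod m) (ε : Fin n → Bool) : X :=
  ∑ S ∈ Finset.powersetCard i (Finset.univ : Finset (Fin n)),
    ∑ δ ∈ Finset.univ.filter (fun δ : Fin n → Bool =>
        (∀ j, j ∉ S → δ j = true) ∧
        (∑ j ∈ S, (if δ j then (1 : ℤ) else -1) * (if ε j then 1 else -1)) = (i : ℤ) - 2 * l),
      (Delta m n k Sᶜ f (x + k • signVecOn m n S δ + signVecOn m n Sᶜ ε) -
       Delta m n k Sᶜ f (x + k • signVecOn m n S δ - signVecOn m n Sᶜ ε))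

namespace RB

/-- sign of a boolean -/
noncomputable def sg (b : Bool) : ℝ := if b then 1 else -1

/-- permutation from an involution -/
def invPerm {α : Type*} (f : α → α) (h : ∀ x, f (f x) = x) : α ≃ α := ⟨f, f, h, h⟩

lemma invPerm_apply {α : Type*} (f : α → α) (h : ∀ x, f (f x) = x) (x : α) :
    invPerm f h x = f x := rfl

/-- biased product weight on the cube -/
noncomputable def W {n : ℕ} (ρ : ℝ) (ξ : Fin n → Bool) : ℝ := ∏ j, (1 + ρ * sg (ξ j)) / 2

/-- coordinatewise product of signs -/
def mulB {n : ℕ} (ξ ε : Fin n → Bool) : Fin n → Bool := fun j => (ξ j == ε j)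

/-- flip of the `j`-th sign -/
def flp {n : ℕ} (j : Fin n) (ε : Fin n → Bool) : Fin n → Bool := Function.update ε j (!ε j)

/-- the `j`-th part of the derivative of the weight -/
noncomputable def dW {n : ℕ} (ρ : ℝ) (j : Fin n) (ξ : Fin n → Bool) : ℝ :=
  (∏ i ∈ univ.erase j, (1 + ρ * sg (ξ i)) / 2) * (sg (ξ j) / 2)

lemma sg_not (b : Bool) : sg (!b) = - sg b := by cases b <;> simp [sg]

lemma flp_flp {n : ℕ} (j : Fin n) (ε : Fin n → Bool) : flp j (flp j ε) = ε := by
  simp [flp]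

lemma mulB_flp {n : ℕ} (j : Fin n) (ξ ε : Fin n → Bool) :
    mulB (flp j ξ) ε = flp j (mulB ξ ε) := by
  funext i
  by_cases h : i = j
  · subst h; simp only [mulB, flp, Function.update_self]; cases ξ i <;> cases ε i <;> rfl
  · simp [mulB, flp, h]

lemma mulB_mulB {n : ℕ} (ξ ε : Fin n → Bool) : mulB ξ (mulB ξ ε) = ε := by
  funext i
  simp only [mulB]; cases ξ i <;> cases ε i <;> rfl

lemma jensen {ι X : Type*} [NormedAddCommGroup X] [NormedSpace ℝ X] (s : Finset ι)
    (w : ι → ℝ) (v : ι → X) (hw : ∀ i ∈ s, 0 ≤ w i) (hw1 : ∑ i ∈ s, w i = 1) {p : ℝ}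
    (hp : 1 ≤ p) : ‖∑ i ∈ s, w i • v i‖ ^ p ≤ ∑ i ∈ s, w i * ‖v i‖ ^ p := by
  refine le_trans ?_ (Real.rpow_arith_mean_le_arith_mean_rpow s w (fun i => ‖v i‖) hw hw1
    (fun _ _ => norm_nonneg _) hp)
  refine Real.rpow_le_rpow (norm_nonneg _) ?_ (by linarith)
  refine (norm_sum_le _ _).trans (Finset.sum_le_sum fun i hi => ?_)
  rw [norm_smul, Real.norm_of_nonneg (hw i hi)]

lemma sum_pow {ι X : Type*} [NormedAddCommGroup X] (s : Finset ι)
    (v : ι → X) {p : ℝ} (hp : 1 ≤ p) :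
    ‖∑ i ∈ s, v i‖ ^ p ≤ (s.card : ℝ) ^ (p - 1) * ∑ i ∈ s, ‖v i‖ ^ p := by
  have h := Real.rpow_sum_le_const_mul_sum_rpow s (fun i => ‖v i‖) hp
  simp only [abs_norm] at h
  exact (Real.rpow_le_rpow (norm_nonneg _) (norm_sum_le _ _) (by linarith)).trans h

lemma W_nonneg {n : ℕ} {ρ : ℝ} (h1 : -1 ≤ ρ) (h2 : ρ ≤ 1) (ξ : Fin n → Bool) : 0 ≤ W ρ ξ := by
  refine Finset.prod_nonneg fun j _ => ?_
  cases ξ j <;> simp [sg] <;> linarith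

lemma sum_W_mul {n : ℕ} (ρ : ℝ) (j : Fin n) (g : Bool → ℝ) :
    ∑ ξ : Fin n → Bool, W ρ ξ * g (ξ j) = (1 + ρ) / 2 * g true + (1 - ρ) / 2 * g false := by
  have h := Fintype.prod_sum (fun (i : Fin n) (b : Bool) =>
    (1 + ρ * sg b) / 2 * (if i = j then g b else 1))
  have h2 : ∀ ξ : Fin n → Bool, W ρ ξ * g (ξ j) =
      ∏ i, ((1 + ρ * sg (ξ i)) / 2 * (if i = j then g (ξ i) else 1)) := by
    intro ξ
    rw [Finset.prod_mul_distrib, Finset.prod_ite_eq' univ j]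
    simp [W]
  rw [Finset.sum_congr rfl fun ξ _ => h2 ξ, ← h, Finset.prod_eq_single j]
  · simp [sg, sub_eq_add_neg]
  · intro i _ hi
    simp [hi, sg]; ring
  · simp

lemma sum_W {n : ℕ} (ρ : ℝ) : ∑ ξ : Fin n → Bool, W ρ ξ = 1 := by
  have h := Fintype.prod_sum (fun (_ : Fin n) (b : Bool) => (1 + ρ * sg b) / 2)
  unfold W
  rw [← h]
  refine Finset.prod_eq_one fun i _ => ?_
  simp [sg]; ring

/-- swap the coordinates of a pair where `σ` is false -/
def swp {n : ℕ} (σ : Fin n → Bool) (q : (Fin n → Bool) × (Fin n → Bool)) :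
    (Fin n → Bool) × (Fin n → Bool) :=
  (fun j => if σ j then q.1 j else q.2 j, fun j => if σ j then q.2 j else q.1 j)

lemma swp_swp {n : ℕ} (σ : Fin n → Bool) (q : (Fin n → Bool) × (Fin n → Bool)) :
    swp σ (swp σ q) = q := by
  ext j <;> simp only [swp] <;> cases σ j <;> simp

lemma W_swp {n : ℕ} (ρ : ℝ) (σ : Fin n → Bool) (q : (Fin n → Bool) × (Fin n → Bool)) :
    W ρ (swp σ q).1 * W ρ (swp σ q).2 = W ρ q.1 * W ρ q.2 := by
  unfold W
  rw [← Finset.prod_mul_distrib, ← Finset.prod_mul_distrib]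
  refine Finset.prod_congr rfl fun j _ => ?_
  simp only [swp]; cases σ j <;> simp [mul_comm]

lemma type_biased {X : Type*} [NormedAddCommGroup X] [NormedSpace ℝ X] {p T : ℝ}
    (hp : 1 ≤ p) (hX : RademacherType X p T) {n : ℕ} {ρ : ℝ} (h1 : -1 ≤ ρ)
    (h2 : ρ ≤ 1) (v : Fin n → X) :
    ∑ ξ : Fin n → Bool, W ρ ξ * ‖∑ j, (sg (ξ j) - ρ) • v j‖ ^ p ≤
      T ^ p * (2 ^ (p - 1) * (1 - ρ ^ 2)) * ∑ j, ‖v j‖ ^ p := by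
  -- step 1 : symmetrize
  have s1 : ∑ ξ : Fin n → Bool, W ρ ξ * ‖∑ j, (sg (ξ j) - ρ) • v j‖ ^ p ≤
      ∑ q : (Fin n → Bool) × (Fin n → Bool),
        W ρ q.1 * W ρ q.2 * ‖∑ j, (sg (q.1 j) - sg (q.2 j)) • v j‖ ^ p := by
    rw [Fintype.sum_prod_type]
    refine Finset.sum_le_sum fun ξ _ => ?_
    simp only [mul_assoc]
    rw [← Finset.mul_sum]
    refine mul_le_mul_of_nonneg_left ?_ (W_nonneg h1 h2 ξ)
    refine le_trans (le_of_eq ?_) (jensen univ (W ρ)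
      (fun η => ∑ j, (sg (ξ j) - sg (η j)) • v j) (fun i _ => W_nonneg h1 h2 i) (sum_W ρ) hp)
    congr 2
    simp only [Finset.smul_sum, smul_smul]
    rw [Finset.sum_comm]
    refine Finset.sum_congr rfl fun j _ => ?_
    rw [← Finset.sum_smul, sum_W_mul ρ j (fun b => sg (ξ j) - sg b)]
    congr 1
    simp [sg]; ring
  -- step 2 : average over the swaps
  have s2 : ∀ σ : Fin n → Bool, ∑ q : (Fin n → Bool) × (Fin n → Bool),
        W ρ q.1 * W ρ q.2 * ‖∑ j, (sg (q.1 j) - sg (q.2 j)) • v j‖ ^ p =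
      ∑ q : (Fin n → Bool) × (Fin n → Bool),
        W ρ q.1 * W ρ q.2 *
          ‖∑ j, (if σ j then (1 : ℝ) else -1) • ((sg (q.1 j) - sg (q.2 j)) • v j)‖ ^ p := by
    intro σ
    rw [← Equiv.sum_comp (invPerm (swp σ) (swp_swp σ))]
    refine Finset.sum_congr rfl fun q _ => ?_
    simp only [invPerm_apply, W_swp]
    congr 3
    refine Finset.sum_congr rfl fun j _ => ?_
    rw [smul_smul]; congr 1
    simp only [swp]; cases σ j <;> simp
  have hcard : (2 : ℝ) ^ n ≠ 0 := by positivity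
  have s3 : ∑ q : (Fin n → Bool) × (Fin n → Bool),
        W ρ q.1 * W ρ q.2 * ‖∑ j, (sg (q.1 j) - sg (q.2 j)) • v j‖ ^ p =
      ∑ q : (Fin n → Bool) × (Fin n → Bool), W ρ q.1 * W ρ q.2 *
        ((∑ σ : Fin n → Bool,
          ‖∑ j, (if σ j then (1 : ℝ) else -1) • ((sg (q.1 j) - sg (q.2 j)) • v j)‖ ^ p)
            / 2 ^ n) := by
    have := Finset.sum_congr (rfl : (univ : Finset (Fin n → Bool)) = univ) fun σ _ => s2 σ
    rw [Finset.sum_const, Finset.sum_comm] at this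
    simp only [Finset.card_univ, Fintype.card_fun, Fintype.card_bool, Fintype.card_fin,
      nsmul_eq_mul, Nat.cast_pow, Nat.cast_ofNat] at this
    simp only [mul_div_assoc']
    rw [← Finset.sum_div, eq_div_iff hcard, mul_comm, this]
    refine Finset.sum_congr rfl fun q _ => ?_
    rw [Finset.mul_sum]
  refine s1.trans (s3.le.trans ?_)
  have s4 : ∀ q : (Fin n → Bool) × (Fin n → Bool), W ρ q.1 * W ρ q.2 *
        ((∑ σ : Fin n → Bool,
          ‖∑ j, (if σ j then (1 : ℝ) else -1) • ((sg (q.1 j) - sg (q.2 j)) • v j)‖ ^ p)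
            / 2 ^ n) ≤ W ρ q.1 * W ρ q.2 *
          (T ^ p * ∑ j, |sg (q.1 j) - sg (q.2 j)| ^ p * ‖v j‖ ^ p) := by
    intro q
    refine mul_le_mul_of_nonneg_left ?_ (mul_nonneg (W_nonneg h1 h2 _) (W_nonneg h1 h2 _))
    refine (hX n _).trans (le_of_eq ?_)
    congr 1
    refine Finset.sum_congr rfl fun j _ => ?_
    rw [norm_smul, Real.norm_eq_abs, Real.mul_rpow (abs_nonneg _) (norm_nonneg _)]
  refine (Finset.sum_le_sum fun q _ => s4 q).trans (le_of_eq ?_)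
  have s5 : ∀ j : Fin n, ∑ q : (Fin n → Bool) × (Fin n → Bool),
      W ρ q.1 * W ρ q.2 * |sg (q.1 j) - sg (q.2 j)| ^ p = 2 ^ (p - 1) * (1 - ρ ^ 2) := by
    intro j
    rw [Fintype.sum_prod_type]
    have : ∀ ξ : Fin n → Bool, ∑ η : Fin n → Bool,
        W ρ ξ * W ρ η * |sg (ξ j) - sg (η j)| ^ p =
        W ρ ξ * ((fun b => (1 + ρ) / 2 * |sg b - sg true| ^ p +
          (1 - ρ) / 2 * |sg b - sg false| ^ p) (ξ j)) := by
      intro ξ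
      simp only [mul_assoc]
      rw [← Finset.mul_sum, sum_W_mul ρ j (fun b => |sg (ξ j) - sg b| ^ p)]
    rw [Finset.sum_congr rfl fun ξ _ => this ξ, sum_W_mul ρ j (fun b => (1 + ρ) / 2 * |sg b - sg true| ^ p +
          (1 - ρ) / 2 * |sg b - sg false| ^ p)]
    have hp0 : p ≠ 0 := by linarith
    have e1 : |(1 : ℝ) + 1| = 2 := by norm_num
    have e2 : |(-1 : ℝ) - 1| = 2 := by norm_num
    have e3 : (2 : ℝ) ^ p = 2 ^ (p - 1) * 2 := by
      rw [← Real.rpow_add_one (by norm_num)]; congr 1; ring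
    simp [sg, Real.zero_rpow hp0, e1, e2, e3]
    ring
  simp only [Finset.mul_sum]
  rw [Finset.sum_comm]
  refine Finset.sum_congr rfl fun j _ => ?_
  rw [← s5 j, Finset.mul_sum, Finset.sum_mul]
  refine Finset.sum_congr rfl fun q _ => ?_
  ring

lemma dW_flp {n : ℕ} (ρ : ℝ) (j : Fin n) (ξ : Fin n → Bool) : dW ρ j (flp j ξ) = - dW ρ j ξ := by
  unfold dW
  have : ∏ i ∈ univ.erase j, (1 + ρ * sg (flp j ξ i)) / 2 =
      ∏ i ∈ univ.erase j, (1 + ρ * sg (ξ i)) / 2 := by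
    refine Finset.prod_congr rfl fun i hi => ?_
    simp [flp, Finset.ne_of_mem_erase hi]
  rw [this]
  simp only [flp, Function.update_self, sg_not]; ring

lemma dW_eq {n : ℕ} {ρ : ℝ} (hρ : 1 - ρ ^ 2 ≠ 0) (j : Fin n) (ξ : Fin n → Bool) :
    dW ρ j ξ = W ρ ξ * ((1 - ρ ^ 2)⁻¹ * (sg (ξ j) - ρ)) := by
  unfold dW W
  rw [← Finset.prod_erase_mul univ _ (Finset.mem_univ j), mul_assoc]
  congr 1
  have : sg (ξ j) * sg (ξ j) = 1 := by cases ξ j <;> simp [sg]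
  field_simp
  linear_combination (-ρ) * this

/-- half difference -/
noncomputable def D {X : Type*} [NormedAddCommGroup X] [NormedSpace ℝ X] {n : ℕ} (j : Fin n)
    (h : (Fin n → Bool) → X) (ε : Fin n → Bool) : X := (1 / 2 : ℝ) • (h ε - h (flp j ε))

lemma sum_dW {X : Type*} [NormedAddCommGroup X] [NormedSpace ℝ X] {n : ℕ} (ρ : ℝ) (j : Fin n)
    (h : (Fin n → Bool) → X) (ε : Fin n → Bool) :
    ∑ ξ, dW ρ j ξ • h (mulB ξ ε) = ∑ ξ, dW ρ j ξ • D j h (mulB ξ ε) := by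
  have e : ∑ ξ, dW ρ j ξ • h (flp j (mulB ξ ε)) = - ∑ ξ, dW ρ j ξ • h (mulB ξ ε) := by
    rw [← Equiv.sum_comp (invPerm (flp j) (flp_flp j)),
      ← Finset.sum_neg_distrib]
    refine Finset.sum_congr rfl fun ξ _ => ?_
    simp only [invPerm_apply, dW_flp, mulB_flp, flp_flp, neg_smul]
  simp only [D, smul_comm _ (1 / 2 : ℝ)]
  rw [← Finset.smul_sum]
  simp only [smul_sub, Finset.sum_sub_distrib]
  rw [e, smul_neg, sub_neg_eq_add, ← add_smul]
  norm_num

lemma deriv_bound {X : Type*} [NormedAddCommGroup X] [NormedSpace ℝ X] {p T : ℝ}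
    (hp : 1 ≤ p) (hX : RademacherType X p T) {n : ℕ} {ρ : ℝ} (h1 : -1 < ρ)
    (h2 : ρ < 1) (h : (Fin n → Bool) → X) :
    ∑ ε, ‖∑ ξ, (∑ j, dW ρ j ξ) • h (mulB ξ ε)‖ ^ p ≤
      ((1 - ρ ^ 2)⁻¹) ^ p * (T ^ p * (2 ^ (p - 1) * (1 - ρ ^ 2))) *
        ∑ ε, ∑ j, ‖D j h ε‖ ^ p := by
  have hρ : 0 < 1 - ρ ^ 2 := by nlinarith
  have e : ∀ ε, ∑ ξ, (∑ j, dW ρ j ξ) • h (mulB ξ ε) =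
      ∑ ξ, W ρ ξ • ((1 - ρ ^ 2)⁻¹ • ∑ j, (sg (ξ j) - ρ) • D j h (mulB ξ ε)) := by
    intro ε
    simp only [Finset.sum_smul]
    rw [Finset.sum_comm, Finset.sum_congr rfl fun j _ => sum_dW ρ j h ε, Finset.sum_comm]
    refine Finset.sum_congr rfl fun ξ _ => ?_
    rw [Finset.smul_sum, Finset.smul_sum]
    refine Finset.sum_congr rfl fun j _ => ?_
    rw [dW_eq hρ.ne', smul_smul, smul_smul, mul_assoc]
  have b : ∀ ε, ‖∑ ξ, (∑ j, dW ρ j ξ) • h (mulB ξ ε)‖ ^ p ≤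
      ∑ ξ, W ρ ξ * (((1 - ρ ^ 2)⁻¹) ^ p * ‖∑ j, (sg (ξ j) - ρ) • D j h (mulB ξ ε)‖ ^ p) := by
    intro ε
    rw [e]
    refine (jensen univ (W ρ) _ (fun i _ => W_nonneg h1.le h2.le i) (sum_W ρ) hp).trans
      (le_of_eq ?_)
    refine Finset.sum_congr rfl fun ξ _ => ?_
    rw [norm_smul, Real.norm_of_nonneg (inv_nonneg.2 hρ.le),
      Real.mul_rpow (inv_nonneg.2 hρ.le) (norm_nonneg _)]
  refine (Finset.sum_le_sum fun ε _ => b ε).trans ?_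
  rw [Finset.sum_comm]
  have c : ∀ ξ : Fin n → Bool, ∑ ε, W ρ ξ * (((1 - ρ ^ 2)⁻¹) ^ p *
      ‖∑ j, (sg (ξ j) - ρ) • D j h (mulB ξ ε)‖ ^ p) =
      ∑ ε, ((1 - ρ ^ 2)⁻¹) ^ p * (W ρ ξ * ‖∑ j, (sg (ξ j) - ρ) • D j h ε‖ ^ p) := by
    intro ξ
    rw [← Equiv.sum_comp (invPerm (mulB ξ) (mulB_mulB ξ))
      (fun ε => ((1 - ρ ^ 2)⁻¹) ^ p * (W ρ ξ * ‖∑ j, (sg (ξ j) - ρ) • D j h ε‖ ^ p))]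
    refine Finset.sum_congr rfl fun ε _ => ?_
    simp only [invPerm_apply]
    ring
  rw [Finset.sum_congr rfl fun ξ _ => c ξ, Finset.sum_comm, Finset.mul_sum]
  refine Finset.sum_le_sum fun ε _ => ?_
  rw [← Finset.mul_sum, mul_assoc]
  refine mul_le_mul_of_nonneg_left (type_biased hp hX h1.le h2.le _) ?_
  positivity

lemma hasDeriv_W {n : ℕ} (ξ : Fin n → Bool) (θ : ℝ) :
    HasDerivAt (fun θ => W (Real.sin θ) ξ) (Real.cos θ * ∑ j, dW (Real.sin θ) j ξ) θ := by
  have h : HasDerivAt (fun ρ : ℝ => W ρ ξ) (∑ j, dW (Real.sin θ) j ξ) (Real.sin θ) := by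
    have := HasDerivAt.fun_finsetProd (u := univ) (f := fun (j : Fin n) (ρ : ℝ) =>
      (1 + ρ * sg (ξ j)) / 2) (f' := fun j => sg (ξ j) / 2) (x := Real.sin θ) (by
        intro j _
        simpa using (((hasDerivAt_id (Real.sin θ)).mul_const (sg (ξ j))).const_add 1).div_const 2)
    simpa [W, dW] using this
  have := h.comp θ (Real.hasDerivAt_sin θ)
  rw [mul_comm]
  exact this

lemma W_one {n : ℕ} (ξ : Fin n → Bool) : W 1 ξ = if ξ = (fun _ => true) then 1 else 0 := by
  split_ifs with h
  · subst h; simp [W, sg]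
  · obtain ⟨j, hj⟩ := Function.ne_iff.1 h
    refine Finset.prod_eq_zero (Finset.mem_univ j) ?_
    simp at hj; simp [sg, hj]

lemma W_neg_one {n : ℕ} (ξ : Fin n → Bool) :
    W (-1) ξ = if ξ = (fun _ => false) then 1 else 0 := by
  split_ifs with h
  · subst h; simp [W, sg]
  · obtain ⟨j, hj⟩ := Function.ne_iff.1 h
    refine Finset.prod_eq_zero (Finset.mem_univ j) ?_
    simp at hj; simp [sg, hj]

lemma cube_ineq {X : Type*} [NormedAddCommGroup X] [NormedSpace ℝ X] {p T : ℝ}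
    (hp : 1 ≤ p) (hp2 : p ≤ 2) (hT : 0 ≤ T) (hX : RademacherType X p T) {n : ℕ}
    (h : (Fin n → Bool) → X) :
    ∑ ε, ‖h ε - h (fun j => !ε j)‖ ^ p ≤
      Real.pi ^ p * (T ^ p * 2 ^ (p - 1)) * ∑ ε, ∑ j, ‖D j h ε‖ ^ p := by
  have hp0 : 0 < p := by linarith
  have : Fact (1 ≤ ENNReal.ofReal p) := ⟨by simpa using ENNReal.ofReal_le_ofReal hp⟩
  have hpr : (ENNReal.ofReal p).toReal = p := ENNReal.toReal_ofReal hp0.le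
  let F : (Fin n → Bool) → PiLp (ENNReal.ofReal p) (fun _ : Fin n → Bool => X) :=
    fun ξ => WithLp.toLp _ (fun ε => h (mulB ξ ε))
  have hnorm : ∀ v : PiLp (ENNReal.ofReal p) (fun _ : Fin n → Bool => X),
      ‖v‖ ^ p = ∑ ε, ‖v ε‖ ^ p := by
    intro v
    rw [PiLp.norm_eq_sum (by rw [hpr]; exact hp0), hpr, ← Real.rpow_mul
      (Finset.sum_nonneg fun _ _ => Real.rpow_nonneg (norm_nonneg _) _), one_div,
      inv_mul_cancel₀ hp0.ne', Real.rpow_one]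
  set A : ℝ := (T ^ p * 2 ^ (p - 1)) * ∑ ε, ∑ j, ‖D j h ε‖ ^ p with hA
  have hA0 : 0 ≤ A := by positivity
  have hd : ∀ θ : ℝ, HasDerivAt (fun θ => ∑ ξ, W (Real.sin θ) ξ • F ξ)
      (∑ ξ, (Real.cos θ * ∑ j, dW (Real.sin θ) j ξ) • F ξ) θ := fun θ =>
    HasDerivAt.fun_sum fun ξ _ => (hasDeriv_W ξ θ).smul_const (F ξ)
  have hb : ∀ θ ∈ Set.Ico (-(Real.pi / 2)) (Real.pi / 2),
      ‖∑ ξ, (Real.cos θ * ∑ j, dW (Real.sin θ) j ξ) • F ξ‖ ≤ A ^ (1 / p) := by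
    intro θ hθ
    rcases eq_or_lt_of_le hθ.1 with h0 | h0
    · have : Real.cos θ = 0 := by rw [← h0, Real.cos_neg, Real.cos_pi_div_two]
      simp only [this, zero_mul, zero_smul, Finset.sum_const_zero, norm_zero]
      positivity
    have hc : 0 < Real.cos θ := Real.cos_pos_of_mem_Ioo ⟨h0, hθ.2⟩
    have hsc := Real.sin_sq_add_cos_sq θ
    have hs1 : -1 < Real.sin θ := by nlinarith [Real.neg_one_le_sin θ]
    have hs2 : Real.sin θ < 1 := by nlinarith [Real.sin_le_one θ]
    have hq : 1 - Real.sin θ ^ 2 = Real.cos θ ^ 2 := by linarith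
    rw [← Real.rpow_le_rpow_iff (norm_nonneg _) (by positivity) hp0, ← Real.rpow_mul hA0,
      one_div, inv_mul_cancel₀ hp0.ne', Real.rpow_one, hnorm]
    have hdb := deriv_bound hp hX hs1 hs2 h
    have e1 : ∀ ε, ‖(∑ ξ, (Real.cos θ * ∑ j, dW (Real.sin θ) j ξ) • F ξ) ε‖ ^ p =
        Real.cos θ ^ p * ‖∑ ξ, (∑ j, dW (Real.sin θ) j ξ) • h (mulB ξ ε)‖ ^ p := by
      intro ε
      rw [← Real.mul_rpow hc.le (norm_nonneg _)]
      congr 1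
      conv_rhs => rw [← Real.norm_of_nonneg hc.le, ← norm_smul, Finset.smul_sum]
      congr 1
      simp [F, mul_smul]
    rw [Finset.sum_congr rfl fun ε _ => e1 ε, ← Finset.mul_sum]
    refine (mul_le_mul_of_nonneg_left hdb (by positivity)).trans ?_
    rw [hq, hA]
    have e2 : Real.cos θ ^ p * (((Real.cos θ ^ 2)⁻¹) ^ p * Real.cos θ ^ 2) ≤ 1 := by
      rw [← Real.rpow_natCast, ← Real.rpow_neg hc.le, ← Real.rpow_mul hc.le,
        ← Real.rpow_add hc, ← Real.rpow_add hc]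
      refine Real.rpow_le_one hc.le (Real.cos_le_one θ) ?_
      push_cast; linarith
    calc _ = (Real.cos θ ^ p * (((Real.cos θ ^ 2)⁻¹) ^ p * Real.cos θ ^ 2)) *
          (T ^ p * 2 ^ (p - 1) * ∑ ε, ∑ j, ‖D j h ε‖ ^ p) := by ring
      _ ≤ 1 * (T ^ p * 2 ^ (p - 1) * ∑ ε, ∑ j, ‖D j h ε‖ ^ p) :=
          mul_le_mul_of_nonneg_right e2 hA0
      _ = _ := one_mul _
  have hm := norm_image_sub_le_of_norm_deriv_le_segment' (a := -(Real.pi / 2))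
    (b := Real.pi / 2) (fun θ _ => (hd θ).hasDerivWithinAt) hb (Real.pi / 2)
    ⟨by linarith [Real.pi_pos], le_rfl⟩
  simp only [Real.sin_neg, Real.sin_pi_div_two, W_one, W_neg_one, ite_smul, one_smul, zero_smul,
    Finset.sum_ite_eq', Finset.mem_univ, if_true] at hm
  have hm2 := Real.rpow_le_rpow (norm_nonneg _) hm hp0.le
  rw [hnorm, Real.mul_rpow (by positivity) (by linarith [Real.pi_pos]),
    ← Real.rpow_mul hA0, one_div, inv_mul_cancel₀ hp0.ne', Real.rpow_one] at hm2
  have e : Real.pi / 2 - -(Real.pi / 2) = Real.pi := by ring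
  rw [e] at hm2
  calc _ = _ := ?_
    _ ≤ _ := hm2
    _ = _ := by rw [hA]; ring
  refine Finset.sum_congr rfl fun ε _ => ?_
  congr 2
  simp only [F, PiLp.sub_apply]
  congr 2 <;> (funext j; simp [mulB])

end RB

namespace RB

lemma signVecOn_neg (m n : ℕ) (A : Finset (Fin n)) (ε : Fin n → Bool) :
    signVecOn m n A (fun j => !ε j) = - signVecOn m n A ε := by
  funext j
  simp only [signVecOn, Pi.neg_apply]
  split_ifs <;> simp_all

lemma signVecOn_flp_not_mem (m n : ℕ) (A : Finset (Fin n)) (ε : Fin n → Bool) (j : Fin n)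
    (hj : j ∉ A) : signVecOn m n A (flp j ε) = signVecOn m n A ε := by
  funext i
  by_cases h : i = j
  · subst h; simp [signVecOn, hj]
  · simp [signVecOn, flp, h]

lemma signVecOn_flp_true (m n : ℕ) (A : Finset (Fin n)) (ε : Fin n → Bool) (j : Fin n)
    (hj : j ∈ A) (hε : ε j = true) :
    signVecOn m n A ε = signVecOn m n A (flp j ε) + Pi.single j 1 + Pi.single j 1 := by
  funext i
  by_cases h : i = j
  · subst h; simp [signVecOn, hj, flp, hε]
  · simp [signVecOn, flp, h]

lemma two_step {X : Type*} [NormedAddCommGroup X] [NormedSpace ℝ X] {p : ℝ} (hp : 1 ≤ p)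
    {m n : ℕ} [NeZero m] (g : (Fin n → ZMod m) → X) (u e : Fin n → ZMod m) :
    ∑ x, ‖(1 / 2 : ℝ) • (g (x + (u + e + e)) - g (x + u))‖ ^ p ≤ ∑ x, ‖g (x + e) - g x‖ ^ p := by
  have b : ∀ x, ‖(1 / 2 : ℝ) • (g (x + (u + e + e)) - g (x + u))‖ ^ p ≤
      1 / 2 * ‖g (x + (u + e) + e) - g (x + (u + e))‖ ^ p +
      1 / 2 * ‖g (x + u + e) - g (x + u)‖ ^ p := by
    intro x
    have := jensen (univ : Finset Bool) (fun _ => (1 / 2 : ℝ))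
      (fun b => if b then g (x + (u + e) + e) - g (x + (u + e)) else g (x + u + e) - g (x + u))
      (fun _ _ => by norm_num) (by norm_num) hp
    simp only [Fintype.sum_bool, if_true, Bool.false_eq_true, if_false] at this
    refine le_trans (le_of_eq ?_) this
    rw [← smul_add]
    congr 3
    simp only [add_assoc]
    abel
  refine (Finset.sum_le_sum fun x _ => b x).trans (le_of_eq ?_)
  rw [Finset.sum_add_distrib, ← Finset.mul_sum, ← Finset.mul_sum]
  have t : ∀ a : Fin n → ZMod m, ∑ x, ‖g (x + a + e) - g (x + a)‖ ^ p =
      ∑ x, ‖g (x + e) - g x‖ ^ p := fun a =>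
    Equiv.sum_comp (Equiv.addRight a) (fun x => ‖g (x + e) - g x‖ ^ p)
  rw [t, t]; ring

lemma sum_D_le {X : Type*} [NormedAddCommGroup X] [NormedSpace ℝ X] {p : ℝ} (hp : 1 ≤ p)
    {m n : ℕ} [NeZero m] (g : (Fin n → ZMod m) → X) (B : Finset (Fin n)) (j : Fin n)
    (ε : Fin n → Bool) :
    ∑ x, ‖D j (fun ε => g (x + signVecOn m n B ε)) ε‖ ^ p ≤
      ∑ x, ‖g (x + Pi.single j 1) - g x‖ ^ p := by
  by_cases hj : j ∈ B
  · cases hε : ε j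
    · have h := signVecOn_flp_true m n B (flp j ε) j hj (by simp [flp, hε])
      rw [flp_flp] at h
      refine le_trans (le_of_eq ?_) (two_step hp g (signVecOn m n B ε) (Pi.single j 1))
      refine Finset.sum_congr rfl fun x _ => ?_
      simp only [D]
      rw [← h, norm_smul, norm_smul, norm_sub_rev]
    · have h := signVecOn_flp_true m n B ε j hj hε
      refine le_trans (le_of_eq ?_) (two_step hp g (signVecOn m n B (flp j ε)) (Pi.single j 1))
      refine Finset.sum_congr rfl fun x _ => ?_
      simp only [D]
      rw [← h]
  · simp only [D, signVecOn_flp_not_mem m n B ε j hj, sub_self, smul_zero, norm_zero]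
    rw [Real.zero_rpow (by linarith), Finset.sum_const_zero]
    positivity

lemma Delta_contr {X : Type*} [NormedAddCommGroup X] [NormedSpace ℝ X] {p : ℝ} (hp : 1 ≤ p)
    {m n k : ℕ} [NeZero m] (hk : 0 < k) (B : Finset (Fin n)) (f : (Fin n → ZMod m) → X)
    (e : Fin n → ZMod m) :
    ∑ x, ‖Delta m n k B f (x + e) - Delta m n k B f x‖ ^ p ≤ ∑ x, ‖f (x + e) - f x‖ ^ p := by
  have hne : (LB m n k B).Nonempty := ⟨0, by simp [LB, hk]⟩
  have hc : ((LB m n k B).card : ℝ) ≠ 0 := by exact_mod_cast hne.card_pos.ne'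
  have hw : ∑ y ∈ LB m n k B, ((LB m n k B).card : ℝ)⁻¹ = 1 := by simp [hc]
  have b : ∀ x, ‖Delta m n k B f (x + e) - Delta m n k B f x‖ ^ p ≤
      ∑ y ∈ LB m n k B, ((LB m n k B).card : ℝ)⁻¹ * ‖f (x + y + e) - f (x + y)‖ ^ p := by
    intro x
    refine le_trans (le_of_eq ?_) (jensen (LB m n k B) (fun _ => ((LB m n k B).card : ℝ)⁻¹)
      (fun y => f (x + y + e) - f (x + y)) (fun _ _ => by positivity) hw hp)
    congr 2
    simp only [Delta]
    rw [← Finset.smul_sum, ← smul_sub, Finset.sum_sub_distrib]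
    simp only [add_right_comm]
  refine (Finset.sum_le_sum fun x _ => b x).trans (le_of_eq ?_)
  rw [Finset.sum_comm]
  have t : ∀ a : Fin n → ZMod m, ∑ x, ((LB m n k B).card : ℝ)⁻¹ * ‖f (x + a + e) - f (x + a)‖ ^ p =
      ((LB m n k B).card : ℝ)⁻¹ * ∑ x, ‖f (x + e) - f x‖ ^ p := fun a => by
    rw [Finset.mul_sum]
    exact Equiv.sum_comp (Equiv.addRight a)
      (fun x => ((LB m n k B).card : ℝ)⁻¹ * ‖f (x + e) - f x‖ ^ p)
  rw [Finset.sum_congr rfl fun y _ => t y, ← Finset.sum_mul, hw, one_mul]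

open scoped Classical in
lemma card_le {n i l : ℕ} (S : Finset (Fin n)) (hS : S.card = i) (ε : Fin n → Bool) :
    (Finset.univ.filter (fun δ : Fin n → Bool =>
        (∀ j, j ∉ S → δ j = true) ∧
        (∑ j ∈ S, (if δ j then (1 : ℤ) else -1) * (if ε j then 1 else -1)) =
          (i : ℤ) - 2 * l)).card ≤ i.choose l := by
  rw [← hS, ← Finset.card_powersetCard]
  refine Finset.card_le_card_of_injOn (fun δ => S.filter fun j => δ j ≠ ε j) ?_ ?_
  · intro δ hδ
    simp only [Finset.coe_filter, Finset.mem_univ, true_and, Set.mem_setOf_eq] at hδ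
    simp only [Finset.mem_coe, Finset.mem_powersetCard, Finset.filter_subset, true_and]
    have h2 : ∑ j ∈ S, (if δ j then (1 : ℤ) else -1) * (if ε j then 1 else -1) =
        ∑ j ∈ S, (1 - 2 * (if δ j ≠ ε j then 1 else 0)) := by
      refine Finset.sum_congr rfl fun j _ => ?_
      cases δ j <;> cases ε j <;> simp
    rw [hδ.2, Finset.sum_sub_distrib, ← Finset.mul_sum, Finset.sum_boole] at h2
    simp only [Finset.sum_const, nsmul_eq_mul, mul_one] at h2
    have : (i : ℤ) = S.card := by rw [hS]
    omega
  · intro δ hδ δ' hδ' h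
    simp only [Finset.coe_filter, Finset.mem_univ, true_and, Set.mem_setOf_eq] at hδ hδ'
    funext j
    by_cases hj : j ∈ S
    · have := Finset.ext_iff.1 h j
      simp only [Finset.mem_filter, hj, true_and] at this
      revert this
      cases δ j <;> cases δ' j <;> cases ε j <;> simp
    · rw [hδ.1 j hj, hδ'.1 j hj]

lemma per_S {X : Type*} [NormedAddCommGroup X] [NormedSpace ℝ X] {p T : ℝ}
    (hp : 1 ≤ p) (hp2 : p ≤ 2) (hT : 0 ≤ T) (hX : RademacherType X p T)
    {m n k : ℕ} [NeZero m] (hk : 0 < k) (B : Finset (Fin n)) (f : (Fin n → ZMod m) → X) :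
    ∑ ε : Fin n → Bool, ∑ x, ‖Delta m n k B f (x + signVecOn m n B ε) -
        Delta m n k B f (x - signVecOn m n B ε)‖ ^ p ≤
      Real.pi ^ p * (T ^ p * 2 ^ (p - 1)) *
        (2 ^ n * ∑ j : Fin n, ∑ x, ‖f (x + Pi.single j 1) - f x‖ ^ p) := by
  rw [Finset.sum_comm]
  have b : ∀ x, ∑ ε : Fin n → Bool, ‖Delta m n k B f (x + signVecOn m n B ε) -
        Delta m n k B f (x - signVecOn m n B ε)‖ ^ p ≤
      Real.pi ^ p * (T ^ p * 2 ^ (p - 1)) *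
        ∑ ε, ∑ j, ‖D j (fun ε => Delta m n k B f (x + signVecOn m n B ε)) ε‖ ^ p := by
    intro x
    have := cube_ineq hp hp2 hT hX (fun ε => Delta m n k B f (x + signVecOn m n B ε))
    simpa only [signVecOn_neg, ← sub_eq_add_neg] using this
  refine (Finset.sum_le_sum fun x _ => b x).trans ?_
  rw [← Finset.mul_sum]
  have hpi := Real.pi_pos
  refine mul_le_mul_of_nonneg_left ?_ (by positivity)
  rw [Finset.sum_comm]
  have c : ∀ ε : Fin n → Bool, ∑ x, ∑ j,
      ‖D j (fun ε => Delta m n k B f (x + signVecOn m n B ε)) ε‖ ^ p ≤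
      ∑ j : Fin n, ∑ x, ‖f (x + Pi.single j 1) - f x‖ ^ p := by
    intro ε
    rw [Finset.sum_comm]
    exact Finset.sum_le_sum fun j _ => (sum_D_le hp _ B j ε).trans (Delta_contr hp hk B f _)
  refine (Finset.sum_le_sum fun ε _ => c ε).trans (le_of_eq ?_)
  simp

open scoped Classical in
lemma Rop_bound {X : Type*} [NormedAddCommGroup X] [NormedSpace ℝ X] {p T : ℝ}
    (hp : 1 ≤ p) (hp2 : p ≤ 2) (hT : 0 ≤ T) (hX : RademacherType X p T)
    {m n k i l : ℕ} [NeZero m] (hk : 0 < k) (hl : l ≤ i) (hi : i ≤ n)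
    (f : (Fin n → ZMod m) → X) :
    ∑ x : Fin n → ZMod m, ∑ ε : Fin n → Bool, ‖Rop m n k i l f x ε‖ ^ p ≤
      ((n.choose i : ℝ) ^ p * (i.choose l : ℝ) ^ p) * (Real.pi ^ p * (T ^ p * 2 ^ (p - 1)) *
        (2 ^ n * ∑ j : Fin n, ∑ x, ‖f (x + Pi.single j 1) - f x‖ ^ p)) := by
  set N : ℝ := (n.choose i : ℝ) with hN
  set M : ℝ := (i.choose l : ℝ) with hM
  have hN0 : 0 < N := by rw [hN]; exact_mod_cast Nat.choose_pos hi
  have hM0 : 0 < M := by rw [hM]; exact_mod_cast Nat.choose_pos hl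
  set P := Finset.powersetCard i (Finset.univ : Finset (Fin n)) with hP
  have hPc : (P.card : ℝ) = N := by simp [hP, hN]
  set Q : Finset (Fin n) → (Fin n → Bool) → Finset (Fin n → Bool) := fun S ε =>
    Finset.univ.filter (fun δ : Fin n → Bool =>
        (∀ j, j ∉ S → δ j = true) ∧
        (∑ j ∈ S, (if δ j then (1 : ℤ) else -1) * (if ε j then 1 else -1)) =
          (i : ℤ) - 2 * l) with hQ
  have hQc : ∀ S ∈ P, ∀ ε, ((Q S ε).card : ℝ) ≤ M := by
    intro S hS ε
    have := card_le (l := l) S (Finset.mem_powersetCard.1 hS).2 ε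
    exact Nat.cast_le.2 this
  set K := Real.pi ^ p * (T ^ p * 2 ^ (p - 1)) *
        (2 ^ n * ∑ j : Fin n, ∑ x, ‖f (x + Pi.single j 1) - f x‖ ^ p) with hK
  set V : Finset (Fin n) → (Fin n → Bool) → (Fin n → ZMod m) → ℝ := fun S ε y =>
    ‖Delta m n k Sᶜ f (y + signVecOn m n Sᶜ ε) - Delta m n k Sᶜ f (y - signVecOn m n Sᶜ ε)‖ ^ p
    with hV
  have hV0 : ∀ S ε y, 0 ≤ V S ε y := fun S ε y => Real.rpow_nonneg (norm_nonneg _) _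
  have b : ∀ x ε, ‖Rop m n k i l f x ε‖ ^ p ≤ N ^ (p - 1) * ∑ S ∈ P, M ^ (p - 1) *
      ∑ δ ∈ Q S ε, V S ε (x + k • signVecOn m n S δ) := by
    intro x ε
    have h := sum_pow P (fun S => ∑ δ ∈ Q S ε,
      (Delta m n k Sᶜ f (x + k • signVecOn m n S δ + signVecOn m n Sᶜ ε) -
       Delta m n k Sᶜ f (x + k • signVecOn m n S δ - signVecOn m n Sᶜ ε))) hp
    rw [hPc] at h
    refine h.trans (mul_le_mul_of_nonneg_left (Finset.sum_le_sum fun S hS => ?_) (by positivity))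
    refine (sum_pow (Q S ε) _ hp).trans ?_
    refine mul_le_mul_of_nonneg_right (Real.rpow_le_rpow (by positivity) (hQc S hS ε)
      (by linarith)) ?_
    exact Finset.sum_nonneg fun δ _ => Real.rpow_nonneg (norm_nonneg _) _
  have c : ∀ ε, ∑ x, ‖Rop m n k i l f x ε‖ ^ p ≤
      N ^ (p - 1) * ∑ S ∈ P, M ^ (p - 1) * (M * ∑ x, V S ε x) := by
    intro ε
    refine (Finset.sum_le_sum fun x _ => b x ε).trans ?_
    rw [← Finset.mul_sum, Finset.sum_comm]
    refine mul_le_mul_of_nonneg_left (Finset.sum_le_sum fun S hS => ?_) (by positivity)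
    rw [← Finset.mul_sum, Finset.sum_comm]
    refine mul_le_mul_of_nonneg_left ?_ (by positivity)
    have t : ∀ δ, ∑ x, V S ε (x + k • signVecOn m n S δ) = ∑ x, V S ε x := fun δ =>
      Equiv.sum_comp (Equiv.addRight (k • signVecOn m n S δ)) (V S ε)
    rw [Finset.sum_congr rfl fun δ _ => t δ, Finset.sum_const, nsmul_eq_mul]
    exact mul_le_mul_of_nonneg_right (hQc S hS ε) (Finset.sum_nonneg fun x _ => hV0 _ _ _)
  rw [Finset.sum_comm]
  refine (Finset.sum_le_sum fun ε _ => c ε).trans ?_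
  rw [← Finset.mul_sum, Finset.sum_comm]
  have d : ∀ S ∈ P, ∑ ε, M ^ (p - 1) * (M * ∑ x, V S ε x) ≤ M ^ (p - 1) * (M * K) := by
    intro S _
    rw [← Finset.mul_sum, ← Finset.mul_sum]
    refine mul_le_mul_of_nonneg_left (mul_le_mul_of_nonneg_left ?_ hM0.le) (by positivity)
    exact per_S hp hp2 hT hX hk Sᶜ f
  refine (mul_le_mul_of_nonneg_left (Finset.sum_le_sum d) (by positivity)).trans (le_of_eq ?_)
  rw [Finset.sum_const, nsmul_eq_mul, hPc]
  have e : ∀ a : ℝ, 0 < a → a ^ p = a ^ (p - 1) * a := by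
    intro a ha
    rw [← Real.rpow_add_one ha.ne']; congr 1; ring
  rw [e N hN0, e M hM0]; ring

end RB

/-- If `X` has Rademacher type `p ∈ [1,2]` with constant `T`, there is `C = C(p,T) > 0` such
that for all `n ≥ 2`, even `m ≥ 2`, odd `0 < k < m/2`, `0 ≤ l ≤ i ≤ n` and `f : ℤ_m^n → X`,
`∫∫ ‖R_{i,l}f(x,ε)‖^p dτ(ε) dμ(x)
  ≤ C (log n)^p binom(n,i)^p binom(i,l)^p ∑_j ∫ ‖f(x+e_j) - f(x)‖^p dμ(x)`. -/
theorem R_bound (p T : ℝ) (hp₁ : 1 ≤ p) (hp₂ : p ≤ 2) (hT : 0 ≤ T)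
    (X : Type*) [NormedAddCommGroup X] [NormedSpace ℝ X] [CompleteSpace X]
    (hX : RademacherType X p T) :
    ∃ C : ℝ, 0 < C ∧
      ∀ (n m k : ℕ) [NeZero m], 2 ≤ n → 2 ≤ m → m % 2 = 0 →
        Odd k → 0 < k → 2 * k < m → ∀ i l : ℕ, l ≤ i → i ≤ n →
        ∀ f : (Fin n → ZMod m) → X,
          (∑ x : Fin n → ZMod m, ∑ ε : Fin n → Bool,
              ‖Rop m n k i l f x ε‖ ^ p) / ((m : ℝ) ^ n * 2 ^ n) ≤
            C * Real.log n ^ p * (n.choose i : ℝ) ^ p * (i.choose l : ℝ) ^ p *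
              ∑ j : Fin n,
                (∑ x : Fin n → ZMod m, ‖f (x + Pi.single j 1) - f x‖ ^ p) / (m : ℝ) ^ n := by
  have hpi := Real.pi_pos
  have hlog2 : 0 < Real.log 2 := Real.log_pos (by norm_num)
  set K := Real.pi ^ p * (T ^ p * 2 ^ (p - 1)) with hK
  have hK0 : 0 ≤ K := by positivity
  refine ⟨(K + 1) / Real.log 2 ^ p, by positivity, ?_⟩
  intro n m k _ hn hm _ _ hk _ i l hl hi f
  have h := RB.Rop_bound hp₁ hp₂ hT hX hk hl hi f
  rw [← hK] at h
  have hm0 : (0 : ℝ) < (m : ℝ) ^ n := by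
    have : (0 : ℝ) < m := by exact_mod_cast (by omega : 0 < m)
    positivity
  set E := ∑ j : Fin n, ∑ x : Fin n → ZMod m, ‖f (x + Pi.single j 1) - f x‖ ^ p with hE
  have hE0 : 0 ≤ E := by positivity
  rw [← Finset.sum_div, ← hE, div_le_iff₀ (by positivity)]
  refine h.trans ?_
  have hlog : 1 ≤ Real.log n ^ p / Real.log 2 ^ p := by
    rw [one_le_div (by positivity)]
    refine Real.rpow_le_rpow hlog2.le (Real.log_le_log (by norm_num) ?_) (by linarith)
    exact_mod_cast hn
  have e : (K + 1) / Real.log 2 ^ p * Real.log n ^ p * (n.choose i : ℝ) ^ p *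
      (i.choose l : ℝ) ^ p * (E / (m : ℝ) ^ n) * ((m : ℝ) ^ n * 2 ^ n) =
      ((n.choose i : ℝ) ^ p * (i.choose l : ℝ) ^ p) *
        ((K + 1) * (Real.log n ^ p / Real.log 2 ^ p) * (2 ^ n * E)) := by
    field_simp
  rw [e]
  refine mul_le_mul_of_nonneg_left ?_ (by positivity)
  refine mul_le_mul_of_nonneg_right ?_ (by positivity)
  nlinarith
end

section
/- Let p ∈ [1,2] and let X be a Banach space with Rademacher type p with constant T. There exists a constant C = C(p,T) > 0 such that for every n ≥ 2, every even integer m ≥ 2, every subset S ⊆ [n], and every f : ℤ_m^n → X, ∫_{ℤ_m^n} ∫_{{−1,1}^n} ‖f(x + ε_{[n]∖S}) − f(x − ε_{[n]∖S})‖_X^p dτ(ε) dμ(x) ≤ C (log n)^p Σ_{j=1}^n ∫_{ℤ_m^n} ‖f(x + e_j) − f(x)‖_X^p dμ(x). -/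
open Finset

section PisierAux

variable {n : ℕ}

/-- sign attached to a flip bit -/
def sgB (c : Bool) : ℝ := if c then -1 else 1

/-- biased one-bit weight -/
noncomputable def qB (t : ℝ) (c : Bool) : ℝ := (1 + t * sgB c) / 2

/-- product weight -/
noncomputable def wB (t : ℝ) (b : Fin n → Bool) : ℝ := ∏ i, qB t (b i)

/-- normalised centred sign -/
noncomputable def aB (t : ℝ) (c : Bool) : ℝ := (sgB c - t) / (1 - t ^ 2)

/-- pointwise xor -/
def bxB (e b : Fin n → Bool) : Fin n → Bool := fun j => xor (e j) (b j)

/-- flip one coordinate -/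
def flipB (j : Fin n) (e : Fin n → Bool) : Fin n → Bool := Function.update e j (!(e j))

lemma flipB_invol (j : Fin n) : Function.Involutive (flipB j) := by
  intro e
  simp [flipB]

lemma bxB_comm (e b : Fin n → Bool) : bxB e b = bxB b e := by
  funext j; simp [bxB, Bool.xor_comm]

lemma bxB_invol (b : Fin n → Bool) : Function.Involutive (fun e => bxB e b) := by
  intro e
  funext j
  simp [bxB]

lemma bxB_flip (e b : Fin n → Bool) (j : Fin n) : bxB e (flipB j b) = flipB j (bxB e b) := by
  funext i
  by_cases h : i = j
  · subst h; simp [bxB, flipB]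
  · simp [bxB, flipB, h]

lemma qB_nonneg {t : ℝ} (h0 : 0 ≤ t) (h1 : t ≤ 1) (c : Bool) : 0 ≤ qB t c := by
  cases c <;> simp [qB, sgB] <;> linarith

lemma wB_nonneg {t : ℝ} (h0 : 0 ≤ t) (h1 : t ≤ 1) (b : Fin n → Bool) : 0 ≤ wB t b :=
  Finset.prod_nonneg fun i _ => qB_nonneg h0 h1 _

lemma sum_prod_bool (g : Fin n → Bool → ℝ) :
    ∑ b : Fin n → Bool, ∏ i, g i (b i) = ∏ i, ∑ c, g i c := by
  rw [Finset.prod_univ_sum, Fintype.piFinset_univ]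

lemma qB_sum (t : ℝ) : ∑ c, qB t c = 1 := by
  simp [qB, sgB]; ring

lemma wB_sum (t : ℝ) : ∑ b : Fin n → Bool, wB t b = 1 := by
  unfold wB
  rw [sum_prod_bool (fun _ c => qB t c)]
  simp only [qB_sum]
  simp

lemma wB_marg (t : ℝ) (j : Fin n) (φ : Bool → ℝ) :
    ∑ b : Fin n → Bool, wB t b * φ (b j) = ∑ c, qB t c * φ c := by
  have h1 : ∀ b : Fin n → Bool, wB t b * φ (b j)
      = ∏ i, (qB t (b i) * if i = j then φ (b i) else 1) := by
    intro b
    rw [Finset.prod_mul_distrib, Finset.prod_ite_eq' univ j (fun i => φ (b i))]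
    simp [wB]
  simp_rw [h1]
  rw [sum_prod_bool (fun i c => qB t c * if i = j then φ c else 1)]
  rw [Finset.prod_eq_single j]
  · simp
  · intro i _ hi
    simp only [hi, if_false, mul_one, qB_sum]
  · simp

lemma aB_mean {t : ℝ} (j : Fin n) : ∑ b : Fin n → Bool, wB t b * aB t (b j) = 0 := by
  rw [wB_marg]
  simp [qB, aB, sgB]; ring

lemma qa (t : ℝ) (h0 : 0 ≤ t) (h1 : t < 1) (c : Bool) : qB t c * aB t c = sgB c / 2 := by
  have : 1 - t ^ 2 ≠ 0 := by nlinarith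
  unfold qB aB
  cases c <;> simp [sgB] <;> field_simp <;> ring

lemma wa_eq (t : ℝ) (h0 : 0 ≤ t) (h1 : t < 1) (b : Fin n → Bool) (j : Fin n) :
    (∏ i ∈ univ.erase j, qB t (b i)) * (sgB (b j) / 2) = wB t b * aB t (b j) := by
  rw [← qa t h0 h1, wB, ← Finset.prod_erase_mul univ _ (mem_univ j)]
  ring

lemma wa_flip (t : ℝ) (h0 : 0 ≤ t) (h1 : t < 1) (b : Fin n → Bool) (j : Fin n) :
    wB t (flipB j b) * aB t (flipB j b j) = -(wB t b * aB t (b j)) := by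
  rw [← wa_eq t h0 h1, ← wa_eq t h0 h1]
  have : ∏ i ∈ univ.erase j, qB t (flipB j b i) = ∏ i ∈ univ.erase j, qB t (b i) := by
    apply Finset.prod_congr rfl
    intro i hi
    simp [flipB, (Finset.mem_erase.1 hi).1]
  rw [this]
  have : sgB (flipB j b j) = - sgB (b j) := by
    cases h : b j <;> simp [flipB, sgB, h]
  rw [this]; ring

lemma wB_deriv (t : ℝ) (h0 : 0 ≤ t) (h1 : t < 1) (b : Fin n → Bool) :
    HasDerivAt (fun s => wB s b) (∑ j, wB t b * aB t (b j)) t := by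
  have := HasDerivAt.fun_finsetProd (u := (univ : Finset (Fin n)))
    (f := fun i s => qB s (b i)) (f' := fun i => sgB (b i) / 2) (x := t) (by
      intro i _
      have := (((hasDerivAt_id t).mul_const (sgB (b i))).const_add 1).div_const 2
      simpa [qB] using this)
  simp only [smul_eq_mul, wa_eq t h0 h1] at this
  exact this

lemma wB_cont (b : Fin n → Bool) : Continuous (fun s => wB s b) := by
  unfold wB qB
  fun_prop

lemma wB_zero (b : Fin n → Bool) : wB 0 b = (1 / 2) ^ n := by
  simp [wB, qB]

lemma wB_one (b : Fin n → Bool) : wB 1 b = if b = (fun _ => false) then 1 else 0 := by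
  split_ifs with h
  · subst h; simp [wB, qB, sgB]
  · obtain ⟨i, hi⟩ := Function.ne_iff.1 h
    apply Finset.prod_eq_zero (mem_univ i)
    simp at hi
    simp [qB, sgB, hi]

variable {X : Type*} [NormedAddCommGroup X] [NormedSpace ℝ X]

lemma jensen_norm {ι : Type*} [Fintype ι] {p : ℝ} (hp : 1 ≤ p) (w : ι → ℝ) (z : ι → X)
    (hw : ∀ i, 0 ≤ w i) (hs : ∑ i, w i = 1) :
    ‖∑ i, w i • z i‖ ^ p ≤ ∑ i, w i * ‖z i‖ ^ p := by
  calc ‖∑ i, w i • z i‖ ^ p ≤ (∑ i, w i * ‖z i‖) ^ p := by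
        apply Real.rpow_le_rpow (norm_nonneg _) _ (by linarith)
        refine (norm_sum_le _ _).trans (le_of_eq ?_)
        apply Finset.sum_congr rfl
        intro i _
        rw [norm_smul, Real.norm_of_nonneg (hw i)]
    _ ≤ _ := Real.rpow_arith_mean_le_arith_mean_rpow _ _ _ (fun i _ => hw i) hs
        (fun i _ => norm_nonneg _) hp

lemma norm_add_rpow {p : ℝ} (hp : 1 ≤ p) (a b : X) :
    ‖a + b‖ ^ p ≤ 2 ^ p * ((‖a‖ ^ p + ‖b‖ ^ p) / 2) := by
  have h := jensen_norm hp (fun _ : Bool => (1 / 2 : ℝ)) (fun c => if c then (2 : ℝ) • a else (2 : ℝ) • b)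
    (by intro i; norm_num) (by simp)
  simp only [Fintype.sum_bool, smul_smul, if_true, norm_smul] at h
  norm_num [smul_smul, norm_smul] at h
  rw [Real.mul_rpow (by norm_num) (norm_nonneg _), Real.mul_rpow (by norm_num) (norm_nonneg _)] at h
  linarith

/-- swap the coordinates of a pair where `d` is true -/
def swapB (d : Fin n → Bool) (c : (Fin n → Bool) × (Fin n → Bool)) :
    (Fin n → Bool) × (Fin n → Bool) :=
  (fun j => if d j then c.1 j else c.2 j, fun j => if d j then c.2 j else c.1 j)

lemma swapB_invol (d : Fin n → Bool) : Function.Involutive (swapB d) := by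
  rintro ⟨b, c⟩
  ext j <;> simp only [swapB] <;> cases d j <;> simp

lemma swapB_w (t : ℝ) (d : Fin n → Bool) (c : (Fin n → Bool) × (Fin n → Bool)) :
    wB t (swapB d c).1 * wB t (swapB d c).2 = wB t c.1 * wB t c.2 := by
  unfold wB
  rw [← Finset.prod_mul_distrib, ← Finset.prod_mul_distrib]
  apply Finset.prod_congr rfl
  intro j _
  simp only [swapB]
  cases d j <;> simp [mul_comm]

lemma type_biased {p T : ℝ} (hp : 1 ≤ p) (hX : RademacherType X p T) {t : ℝ}
    (h0 : 0 ≤ t) (h1 : t < 1) (v : Fin n → X) :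
    ∑ b : Fin n → Bool, wB t b * ‖∑ j, aB t (b j) • v j‖ ^ p ≤
      T ^ p * ((1 - t ^ 2) / 2 * (2 / (1 - t ^ 2)) ^ p) * ∑ j, ‖v j‖ ^ p := by
  have hw : ∀ b : Fin n → Bool, 0 ≤ wB t b := wB_nonneg h0 h1.le
  have ht2 : 0 < 1 - t ^ 2 := by nlinarith
  set W : (Fin n → Bool) × (Fin n → Bool) → ℝ := fun c => wB t c.1 * wB t c.2 with hW
  set V : (Fin n → Bool) × (Fin n → Bool) → Fin n → X :=
    fun c j => (aB t (c.1 j) - aB t (c.2 j)) • v j with hV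
  -- symmetrisation
  have s1 : ∑ b : Fin n → Bool, wB t b * ‖∑ j, aB t (b j) • v j‖ ^ p ≤
      ∑ c, W c * ‖∑ j, V c j‖ ^ p := by
    rw [Fintype.sum_prod_type]
    apply Finset.sum_le_sum
    intro b _
    simp only [hW, mul_assoc, ← Finset.mul_sum]
    apply mul_le_mul_of_nonneg_left _ (hw b)
    have e : ∑ j, aB t (b j) • v j = ∑ b' : Fin n → Bool, wB t b' • ∑ j, V (b, b') j := by
      simp only [hV, Finset.smul_sum]
      rw [Finset.sum_comm]
      apply Finset.sum_congr rfl
      intro j _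
      simp only [smul_smul]
      rw [← Finset.sum_smul]
      congr 1
      simp only [mul_sub, Finset.sum_sub_distrib, aB_mean, ← Finset.sum_mul, wB_sum]
      ring
    rw [e]
    exact jensen_norm hp _ _ hw (wB_sum t)
  -- swap
  have s2 : ∀ d : Fin n → Bool, ∑ c, W c * ‖∑ j, V c j‖ ^ p =
      ∑ c, W c * ‖∑ j, (if d j then (1 : ℝ) else -1) • V c j‖ ^ p := by
    intro d
    apply Fintype.sum_equiv (swapB_invol d).toPerm
    intro c
    rw [Function.Involutive.coe_toPerm]
    have e1 : W (swapB d c) = W c := swapB_w t d c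
    have e2 : ∀ j, (if d j then (1 : ℝ) else -1) • V (swapB d c) j = V c j := by
      intro j
      simp only [hV, swapB]
      cases d j
      · simp only [Bool.false_eq_true, if_false]
        rw [smul_smul]
        congr 1
        ring
      · simp
    simp only [e1, e2]
  have s3 : ∑ c, W c * ‖∑ j, V c j‖ ^ p ≤ ∑ c, W c * (T ^ p * ∑ j, ‖V c j‖ ^ p) := by
    have : ∑ c, W c * ‖∑ j, V c j‖ ^ p =
       ∑ c, W c * ((∑ d : Fin n → Bool, ‖∑ j, (if d j then (1 : ℝ) else -1) • V c j‖ ^ p) / 2 ^ n) := by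
      have h := Finset.sum_congr (rfl : (univ : Finset (Fin n → Bool)) = univ) (fun d _ => s2 d)
      rw [Finset.sum_const, Finset.sum_comm] at h
      simp only [← Finset.mul_sum] at h
      simp only [← mul_div_assoc, ← Finset.sum_div]
      rw [← h]
      simp
    rw [this]
    apply Finset.sum_le_sum
    intro c _
    exact mul_le_mul_of_nonneg_left (hX n _) (mul_nonneg (hw _) (hw _))
  refine s1.trans (s3.trans (le_of_eq ?_))
  have s4 : ∀ j, ∑ c, W c * ‖V c j‖ ^ p =
      ((1 - t ^ 2) / 2 * (2 / (1 - t ^ 2)) ^ p) * ‖v j‖ ^ p := by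
    intro j
    have e : ∀ c, W c * ‖V c j‖ ^ p =
        (wB t c.1 * (wB t c.2 * |aB t (c.1 j) - aB t (c.2 j)| ^ p)) * ‖v j‖ ^ p := by
      intro c
      simp only [hW, hV, norm_smul, Real.norm_eq_abs]
      rw [Real.mul_rpow (abs_nonneg _) (norm_nonneg _)]
      ring
    simp only [e]
    rw [← Finset.sum_mul, Fintype.sum_prod_type]
    congr 1
    simp only [← Finset.mul_sum]
    have e2 : ∀ b : Fin n → Bool,
        ∑ b' : Fin n → Bool, wB t b' * |aB t (b j) - aB t (b' j)| ^ p =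
        ∑ c, qB t c * |aB t (b j) - aB t c| ^ p :=
      fun b => wB_marg t j (fun c => |aB t (b j) - aB t c| ^ p)
    simp only [e2]
    rw [wB_marg t j (fun c' => ∑ c, qB t c * |aB t c' - aB t c| ^ p)]
    have a1 : |aB t true - aB t false| = 2 / (1 - t ^ 2) := by
      rw [abs_sub_comm, abs_of_nonneg]
      · simp [aB, sgB]; ring
      · simp only [aB, sgB]
        rw [← sub_div]
        apply div_nonneg _ ht2.le
        norm_num
    have a2 : |aB t false - aB t true| = 2 / (1 - t ^ 2) := by rw [abs_sub_comm, a1]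
    have hp0 : p ≠ 0 := by linarith
    simp only [Fintype.sum_bool, a1, a2, sub_self, abs_zero, Real.zero_rpow hp0]
    simp [qB, sgB]; ring
  simp only [mul_left_comm _ (T ^ p), ← Finset.mul_sum]
  rw [mul_assoc]
  congr 1
  simp only [Finset.mul_sum]
  rw [Finset.sum_comm]
  simp only [s4]

/-- discrete derivative -/
noncomputable def dB (j : Fin n) (h : (Fin n → Bool) → X) (e : Fin n → Bool) : X :=
  (1 / 2 : ℝ) • (h e - h (flipB j e))

lemma deriv_repr (t : ℝ) (h0 : 0 ≤ t) (h1 : t < 1) (h : (Fin n → Bool) → X) (e : Fin n → Bool) :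
    ∑ b : Fin n → Bool, (∑ j, wB t b * aB t (b j)) • h (bxB e b) =
      ∑ b : Fin n → Bool, wB t b • ∑ j, aB t (b j) • dB j h (bxB e b) := by
  simp only [Finset.sum_smul, Finset.smul_sum, smul_smul]
  rw [Finset.sum_comm, Finset.sum_comm (s := univ) (t := univ)
    (f := fun b j => (wB t b * aB t (b j)) • dB j h (bxB e b))]
  apply Finset.sum_congr rfl
  intro j _
  have e1 : ∑ b : Fin n → Bool, (wB t b * aB t (b j)) • h (flipB j (bxB e b)) =
      - ∑ b : Fin n → Bool, (wB t b * aB t (b j)) • h (bxB e b) := by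
    rw [← Finset.sum_neg_distrib]
    apply Fintype.sum_equiv (flipB_invol j).toPerm
    intro b
    simp only [Function.Involutive.coe_toPerm]
    rw [wa_flip t h0 h1, bxB_flip]
    simp
  simp only [dB, smul_comm _ (1 / 2 : ℝ), ← Finset.smul_sum, smul_sub, Finset.sum_sub_distrib, e1]
  rw [smul_neg, sub_neg_eq_add, ← add_smul]
  norm_num

lemma deriv_bound {p T : ℝ} (hp : 1 ≤ p) (hT : 0 ≤ T) (hX : RademacherType X p T) {t : ℝ}
    (h0 : 0 ≤ t) (h1 : t < 1) (h : (Fin n → Bool) → X) :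
    ∑ e : Fin n → Bool, ‖∑ b : Fin n → Bool, (∑ j, wB t b * aB t (b j)) • h (bxB e b)‖ ^ p ≤
      (2 * T) ^ p * (1 - t) ^ (1 - p) * ∑ e : Fin n → Bool, ∑ j, ‖dB j h e‖ ^ p := by
  have hw : ∀ b : Fin n → Bool, 0 ≤ wB t b := wB_nonneg h0 h1.le
  have ht2 : 0 < 1 - t ^ 2 := by nlinarith
  calc _ ≤ ∑ e : Fin n → Bool, ∑ b : Fin n → Bool,
          wB t b * ‖∑ j, aB t (b j) • dB j h (bxB e b)‖ ^ p := by
        apply Finset.sum_le_sum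
        intro e _
        rw [deriv_repr t h0 h1]
        exact jensen_norm hp _ _ hw (wB_sum t)
    _ = ∑ e : Fin n → Bool, ∑ b : Fin n → Bool,
          wB t b * ‖∑ j, aB t (b j) • dB j h e‖ ^ p := by
        rw [Finset.sum_comm, Finset.sum_comm (s := univ) (t := univ)
          (f := fun e b => wB t b * ‖∑ j, aB t (b j) • dB j h e‖ ^ p)]
        apply Finset.sum_congr rfl
        intro b _
        apply Fintype.sum_equiv (bxB_invol b).toPerm
        intro e
        simp
    _ ≤ ∑ e : Fin n → Bool, T ^ p * ((1 - t ^ 2) / 2 * (2 / (1 - t ^ 2)) ^ p) *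
          ∑ j, ‖dB j h e‖ ^ p :=
        Finset.sum_le_sum fun e _ => type_biased hp hX h0 h1 _
    _ ≤ _ := by
        rw [← Finset.mul_sum]
        apply mul_le_mul_of_nonneg_right
        · rw [Real.div_rpow (by norm_num) ht2.le, Real.mul_rpow (by norm_num) hT]
          have k1 : (1 - t ^ 2) ^ (1 - p) ≤ (1 - t) ^ (1 - p) :=
            Real.rpow_le_rpow_of_nonpos (by linarith) (by nlinarith) (by linarith)
          have k2 : (1 - t ^ 2) ^ (1 - p) = (1 - t ^ 2) / (1 - t ^ 2) ^ p := by
            rw [Real.rpow_sub ht2, Real.rpow_one]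
          have k3 : T ^ p * ((1 - t ^ 2) / 2 * (2 ^ p / (1 - t ^ 2) ^ p)) =
              (2 ^ p * T ^ p) * ((1 - t ^ 2) ^ (1 - p) / 2) := by
            rw [k2]; ring
          rw [k3]
          apply mul_le_mul_of_nonneg_left _ (by positivity)
          have : 0 ≤ (1 - t ^ 2) ^ (1 - p) := by positivity
          linarith
        · positivity

lemma pisier_cube {p T : ℝ} (hp : 1 ≤ p) (hp2 : p ≤ 2) (hT : 0 ≤ T) (hX : RademacherType X p T)
    (h : (Fin n → Bool) → X) :
    ∑ e : Fin n → Bool, ‖h e - ∑ b : Fin n → Bool, ((1 / 2 : ℝ) ^ n) • h b‖ ^ p ≤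
      (4 * T) ^ p * ∑ e : Fin n → Bool, ∑ j, ‖dB j h e‖ ^ p := by
  have hp0 : 0 < p := by linarith
  have : Fact (1 ≤ ENNReal.ofReal p) := ⟨by simpa using hp⟩
  have hpr : (ENNReal.ofReal p).toReal = p := ENNReal.toReal_ofReal hp0.le
  set Q := ∑ e : Fin n → Bool, ∑ j, ‖dB j h e‖ ^ p with hQ
  have hQ0 : 0 ≤ Q := by positivity
  let H : (Fin n → Bool) → PiLp (ENNReal.ofReal p) (fun _ : Fin n → Bool => X) :=
    fun b => WithLp.toLp _ (fun e => h (bxB e b))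
  have hnorm : ∀ F : PiLp (ENNReal.ofReal p) (fun _ : Fin n → Bool => X),
      ‖F‖ = (∑ e, ‖F e‖ ^ p) ^ (1 / p) := by
    intro F
    rw [PiLp.norm_eq_sum (by rw [hpr]; exact hp0), hpr]
  let G : ℝ → PiLp (ENNReal.ofReal p) (fun _ : Fin n → Bool => X) :=
    fun t => ∑ b, wB t b • H b
  have hG : ∀ t e, G t e = ∑ b, wB t b • h (bxB e b) := by
    intro t e
    simp [G, H]
  set M := 2 * T * Q ^ (1 / p) with hM
  have key := image_norm_le_of_norm_deriv_right_le_deriv_boundary'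
    (f := fun t => G t - G 0) (a := 0) (b := 1)
    (f' := fun t => ∑ b, (∑ j, wB t b * aB t (b j)) • H b)
    (B := fun t => M * p * (1 - (1 - t) ^ (1 / p)))
    (B' := fun t => M * (1 - t) ^ (1 / p - 1))
    (by
      apply Continuous.continuousOn
      apply Continuous.sub _ continuous_const
      exact continuous_finsetSum _ fun b _ => (wB_cont b).smul continuous_const)
    (by
      intro t ht
      apply HasDerivAt.hasDerivWithinAt
      apply HasDerivAt.sub_const
      exact HasDerivAt.fun_sum fun b _ => (wB_deriv t ht.1 ht.2 b).smul_const _)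
    (by simp)
    (by
      apply Continuous.continuousOn
      apply Continuous.mul continuous_const
      apply Continuous.sub continuous_const
      exact (continuous_const.sub continuous_id).rpow_const (fun x => Or.inr (by positivity)))
    (by
      intro t ht
      apply HasDerivAt.hasDerivWithinAt
      have d1 : HasDerivAt (fun s : ℝ => 1 - s) (-1) t := by
        simpa using (hasDerivAt_id t).const_sub 1
      have d2 := d1.rpow_const (p := 1 / p) (Or.inl (by linarith [ht.2]))
      have d3 := (d2.const_sub 1).const_mul (M * p)
      have e3 : M * p * -(-1 * (1 / p) * (1 - t) ^ (1 / p - 1)) = M * (1 - t) ^ (1 / p - 1) := by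
        field_simp
      rw [← e3]
      exact d3)
    (by
      intro t ht
      rw [hnorm]
      have hb := deriv_bound hp hT hX ht.1 ht.2 h
      have e1 : ∀ e, (∑ b, (∑ j, wB t b * aB t (b j)) • H b) e =
          ∑ b : Fin n → Bool, (∑ j, wB t b * aB t (b j)) • h (bxB e b) := by
        intro e
        simp [H]
      simp only [e1]
      have h1t : 0 < 1 - t := by linarith [ht.2]
      refine (Real.rpow_le_rpow (by positivity) hb (by positivity)).trans (le_of_eq ?_)
      rw [Real.mul_rpow (by positivity) hQ0, Real.mul_rpow (by positivity) (by positivity),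
        ← Real.rpow_mul (by positivity), ← Real.rpow_mul h1t.le, mul_one_div_cancel hp0.ne',
        Real.rpow_one, hM]
      have : (1 - p) * (1 / p) = 1 / p - 1 := by field_simp
      rw [this]; ring)
    (x := 1) (by simp)
  simp only [sub_self] at key
  rw [Real.zero_rpow (by positivity), hnorm] at key
  have e2 : ∀ e, (G 1 - G 0) e = h e - ∑ b : Fin n → Bool, ((1 / 2 : ℝ) ^ n) • h b := by
    intro e
    rw [PiLp.sub_apply, hG, hG]
    congr 1
    · have e4 : bxB e (fun _ => false) = e := by funext j; simp [bxB]
      simp [wB_one, e4]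
    · simp only [wB_zero]
      apply Fintype.sum_equiv (bxB_invol e).toPerm
      intro b
      simp [bxB_comm]
  simp only [e2] at key
  have k2 := Real.rpow_le_rpow (by positivity) key hp0.le
  rw [← Real.rpow_mul (by positivity), one_div_mul_cancel hp0.ne', Real.rpow_one] at k2
  refine k2.trans ?_
  have k3 : M * p * (1 - 0) ≤ 4 * T * Q ^ (1 / p) := by
    have : 0 ≤ T * Q ^ (1 / p) := by positivity
    rw [hM]; nlinarith
  refine (Real.rpow_le_rpow (by rw [hM]; positivity) k3 hp0.le).trans (le_of_eq ?_)
  rw [Real.mul_rpow (by positivity) (by positivity), ← Real.rpow_mul hQ0,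
    one_div_mul_cancel hp0.ne', Real.rpow_one]

/-- antipode -/
def negB (e : Fin n → Bool) : Fin n → Bool := fun j => !(e j)

lemma negB_invol : Function.Involutive (negB (n := n)) := by
  intro e; funext j; simp [negB]

lemma pisier_antipodal {p T : ℝ} (hp : 1 ≤ p) (hp2 : p ≤ 2) (hT : 0 ≤ T)
    (hX : RademacherType X p T) (h : (Fin n → Bool) → X) :
    ∑ e : Fin n → Bool, ‖h e - h (negB e)‖ ^ p ≤
      (8 * T) ^ p * ∑ e : Fin n → Bool, ∑ j, ‖dB j h e‖ ^ p := by
  have hc := pisier_cube hp hp2 hT hX h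
  set μ := ∑ b : Fin n → Bool, ((1 / 2 : ℝ) ^ n) • h b
  have e1 : ∑ e : Fin n → Bool, ‖h (negB e) - μ‖ ^ p = ∑ e : Fin n → Bool, ‖h e - μ‖ ^ p :=
    Fintype.sum_equiv negB_invol.toPerm _ _ (fun e => by simp)
  calc ∑ e : Fin n → Bool, ‖h e - h (negB e)‖ ^ p
      ≤ ∑ e : Fin n → Bool, 2 ^ p * ((‖h e - μ‖ ^ p + ‖h (negB e) - μ‖ ^ p) / 2) := by
        apply Finset.sum_le_sum
        intro e _
        have := norm_add_rpow hp (h e - μ) (-(h (negB e) - μ))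
        rw [norm_neg] at this
        have e5 : h e - μ + -(h (negB e) - μ) = h e - h (negB e) := by abel
        rw [e5] at this
        exact this
    _ = 2 ^ p * ∑ e : Fin n → Bool, ‖h e - μ‖ ^ p := by
        rw [← Finset.mul_sum, ← Finset.sum_div, Finset.sum_add_distrib, e1]
        ring
    _ ≤ 2 ^ p * ((4 * T) ^ p * ∑ e : Fin n → Bool, ∑ j, ‖dB j h e‖ ^ p) :=
        mul_le_mul_of_nonneg_left hc (by positivity)
    _ = _ := by
        rw [← mul_assoc, ← Real.mul_rpow (by norm_num) (by positivity)]
        congr 2; ring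

lemma two_step {p : ℝ} (hp : 1 ≤ p) {m : ℕ} [NeZero m] (j : Fin n)
    (f : (Fin n → ZMod m) → X) :
    ∑ y : Fin n → ZMod m, ‖(1 / 2 : ℝ) • (f (y + Pi.single j 2) - f y)‖ ^ p ≤
      ∑ y : Fin n → ZMod m, ‖f (y + Pi.single j 1) - f y‖ ^ p := by
  have e1 : ∑ y : Fin n → ZMod m, ‖f (y + Pi.single j 1 + Pi.single j 1) - f (y + Pi.single j 1)‖ ^ p
      = ∑ y : Fin n → ZMod m, ‖f (y + Pi.single j 1) - f y‖ ^ p :=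
    Fintype.sum_equiv (Equiv.addRight (Pi.single j 1)) _ _ (fun y => by simp)
  calc _ ≤ ∑ y : Fin n → ZMod m, ((‖f (y + Pi.single j 1 + Pi.single j 1) - f (y + Pi.single j 1)‖ ^ p
        + ‖f (y + Pi.single j 1) - f y‖ ^ p) / 2) := by
        apply Finset.sum_le_sum
        intro y _
        have := norm_add_rpow hp (f (y + Pi.single j 1 + Pi.single j 1) - f (y + Pi.single j 1))
          (f (y + Pi.single j 1) - f y)
        rw [sub_add_sub_cancel, add_assoc, ← Pi.single_add, one_add_one_eq_two] at this
        rw [norm_smul, Real.mul_rpow (norm_nonneg _) (norm_nonneg _), add_assoc, ← Pi.single_add,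
          one_add_one_eq_two]
        have h2 : ‖(1 / 2 : ℝ)‖ ^ p * 2 ^ p = 1 := by
          rw [← Real.mul_rpow (by positivity) (by positivity)]
          norm_num
        calc _ ≤ ‖(1 / 2 : ℝ)‖ ^ p * _ := mul_le_mul_of_nonneg_left this (by positivity)
          _ = _ := by rw [← mul_assoc, h2, one_mul]
    _ = _ := by
        rw [← Finset.sum_div, Finset.sum_add_distrib, e1]
        ring

lemma sum_dB {p : ℝ} (hp : 1 ≤ p) {m : ℕ} [NeZero m] (A : Finset (Fin n)) (j : Fin n)
    (f : (Fin n → ZMod m) → X) (e : Fin n → Bool) :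
    ∑ x : Fin n → ZMod m, ‖dB j (fun e => f (x + signVecOn m n A e)) e‖ ^ p ≤
      ∑ y : Fin n → ZMod m, ‖f (y + Pi.single j 1) - f y‖ ^ p := by
  by_cases hj : j ∈ A
  · refine le_trans (le_of_eq ?_) (two_step hp j f)
    cases he : e j
    · have hs : signVecOn m n A (flipB j e) = signVecOn m n A e + Pi.single j 2 := by
        funext i
        by_cases h : i = j
        · subst h
          simp [signVecOn, flipB, hj, he]; norm_num
        · simp [signVecOn, flipB, h]
      apply Fintype.sum_equiv (Equiv.addRight (signVecOn m n A e))
      intro x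
      simp only [dB, hs, Equiv.coe_addRight, norm_smul, add_assoc]
      rw [norm_sub_rev]
    · have hs : signVecOn m n A e = signVecOn m n A (flipB j e) + Pi.single j 2 := by
        funext i
        by_cases h : i = j
        · subst h
          simp [signVecOn, flipB, hj, he]; norm_num
        · simp [signVecOn, flipB, h]
      apply Fintype.sum_equiv (Equiv.addRight (signVecOn m n A (flipB j e)))
      intro x
      simp only [dB, Equiv.coe_addRight, add_assoc]
      rw [← hs]
  · have hs : signVecOn m n A (flipB j e) = signVecOn m n A e := by
      funext i
      by_cases h : i = j
      · subst h; simp [signVecOn, hj]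
      · simp [signVecOn, flipB, h]
    have hp0 : p ≠ 0 := by linarith
    simp only [dB, hs, sub_self, smul_zero, norm_zero, Real.zero_rpow hp0, Finset.sum_const_zero]
    positivity

lemma signVec_neg (m : ℕ) (A : Finset (Fin n)) (e : Fin n → Bool) :
    signVecOn m n A (negB e) = - signVecOn m n A e := by
  funext j
  simp only [signVecOn, negB, Pi.neg_apply]
  split_ifs <;> simp_all

end PisierAux

/-- If `X` has Rademacher type `p ∈ [1,2]` with constant `T`, there is `C = C(p,T) > 0` such
that for every `n ≥ 2`, every even `m ≥ 2`, every `S ⊆ [n]` and every `f : ℤ_m^n → X`,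
`∫∫ ‖f(x + ε_{[n]∖S}) - f(x - ε_{[n]∖S})‖^p dτ(ε) dμ(x)
  ≤ C (log n)^p ∑_j ∫ ‖f(x+e_j) - f(x)‖^p dμ(x)`. -/
theorem pisier_diagonal_bound (p T : ℝ) (hp₁ : 1 ≤ p) (hp₂ : p ≤ 2) (hT : 0 ≤ T)
    (X : Type*) [NormedAddCommGroup X] [NormedSpace ℝ X] [CompleteSpace X]
    (hX : RademacherType X p T) :
    ∃ C : ℝ, 0 < C ∧
      ∀ (n m : ℕ) [NeZero m], 2 ≤ n → 2 ≤ m → m % 2 = 0 →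
        ∀ S : Finset (Fin n), ∀ f : (Fin n → ZMod m) → X,
          (∑ x : Fin n → ZMod m, ∑ ε : Fin n → Bool,
              ‖f (x + signVecOn m n Sᶜ ε) - f (x - signVecOn m n Sᶜ ε)‖ ^ p) /
            ((m : ℝ) ^ n * 2 ^ n) ≤
          C * Real.log n ^ p *
            ∑ j : Fin n,
              (∑ x : Fin n → ZMod m, ‖f (x + Pi.single j 1) - f x‖ ^ p) / (m : ℝ) ^ n := by

  have hl2 : 0 < Real.log 2 := Real.log_pos (by norm_num)
  have hp0 : 0 ≤ p := by linarith
  refine ⟨((8 * T) ^ p + 1) / Real.log 2 ^ p, by positivity, ?_⟩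
  intro n m _ hn hm _ S f
  have hm0 : (0 : ℝ) < m := by exact_mod_cast (by omega : 0 < m)
  set E : Fin n → ℝ := fun j => ∑ x : Fin n → ZMod m, ‖f (x + Pi.single j 1) - f x‖ ^ p with hE
  have hE0 : 0 ≤ ∑ j, E j := by positivity
  have main : ∑ x : Fin n → ZMod m, ∑ ε : Fin n → Bool,
      ‖f (x + signVecOn m n Sᶜ ε) - f (x - signVecOn m n Sᶜ ε)‖ ^ p ≤
      (8 * T) ^ p * (2 ^ n * ∑ j, E j) := by
    calc _ ≤ ∑ x : Fin n → ZMod m, (8 * T) ^ p * ∑ e : Fin n → Bool, ∑ j,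
          ‖dB j (fun e => f (x + signVecOn m n Sᶜ e)) e‖ ^ p := by
          apply Finset.sum_le_sum
          intro x _
          have := pisier_antipodal hp₁ hp₂ hT hX (fun e => f (x + signVecOn m n Sᶜ e))
          simpa only [signVec_neg, ← sub_eq_add_neg] using this
      _ = (8 * T) ^ p * ∑ e : Fin n → Bool, ∑ j, ∑ x : Fin n → ZMod m,
          ‖dB j (fun e => f (x + signVecOn m n Sᶜ e)) e‖ ^ p := by
          rw [← Finset.mul_sum, Finset.sum_comm]
          congr 1
          apply Finset.sum_congr rfl
          intro e _
          rw [Finset.sum_comm]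
      _ ≤ (8 * T) ^ p * ∑ e : Fin n → Bool, ∑ j, E j := by
          apply mul_le_mul_of_nonneg_left _ (by positivity)
          exact Finset.sum_le_sum fun e _ => Finset.sum_le_sum fun j _ => sum_dB hp₁ _ j f e
      _ = _ := by simp
  have hlog : 1 ≤ Real.log n ^ p / Real.log 2 ^ p := by
    rw [one_le_div (by positivity)]
    apply Real.rpow_le_rpow hl2.le _ hp0
    exact Real.log_le_log (by norm_num) (by exact_mod_cast hn)
  rw [← Finset.sum_div]
  calc _ ≤ (8 * T) ^ p * (2 ^ n * ∑ j, E j) / ((m : ℝ) ^ n * 2 ^ n) := by gcongr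
    _ = (8 * T) ^ p * ((∑ j, E j) / (m : ℝ) ^ n) := by field_simp
    _ ≤ ((8 * T) ^ p + 1) * (Real.log n ^ p / Real.log 2 ^ p) * ((∑ j, E j) / (m : ℝ) ^ n) := by
        apply mul_le_mul_of_nonneg_right _ (by positivity)
        have : 0 ≤ (8 * T) ^ p := by positivity
        nlinarith
    _ = _ := by ring
end
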